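/- arXiv:math/0108040 — 2 statements merged into one kernel-verified Lean document; each statement's English description precedes it below -/
import Mathlib

section
/- Let H be a Hopf algebra over a field k. The category of Hopf bimodules over H (vector spaces carrying a left H-module, right H-module, left H-comodule and right H-comodule structure, all pairwise compatible) is equivalent to the category of right crossed H-modules (Yetter–Drinfeld modules). -/
/- STATEMENT 0: For a Hopf algebra H over a field k, the category of Hopf
bimodules over H is equivalent to the category of right crossed H-modules
(Yetter-Drinfeld modules). -/

open TensorProduct CategoryTheory

noncomputable section

variable (k : Type) [Field k] (H : Type) [Ring H] [HopfAlgebra k H]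

section Props
variable {k H} {V : Type} [AddCommGroup V] [Module k V]

/-- `ρ : V → V ⊗ H` is a right `H`-comodule structure. -/
def IsRightCoaction (ρ : V →ₗ[k] V ⊗[k] H) : Prop :=
  (∀ v, (TensorProduct.rid k V)
      ((LinearMap.lTensor V (Coalgebra.counit (R := k) (A := H))) (ρ v)) = v) ∧
  (∀ v, (LinearMap.rTensor H ρ) (ρ v) =
    (TensorProduct.assoc k V H H).symm
      ((LinearMap.lTensor V (Coalgebra.comul (R := k) (A := H))) (ρ v)))

/-- `lam : V → H ⊗ V` is a left `H`-comodule structure. -/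
def IsLeftCoaction (lam : V →ₗ[k] H ⊗[k] V) : Prop :=
  (∀ v, (TensorProduct.lid k V)
      ((LinearMap.rTensor V (Coalgebra.counit (R := k) (A := H))) (lam v)) = v) ∧
  (∀ v, (LinearMap.lTensor H lam) (lam v) =
    (TensorProduct.assoc k H H V)
      ((LinearMap.rTensor V (Coalgebra.comul (R := k) (A := H))) (lam v)))

/-- `act : V ⊗ H → V` is a right `H`-module structure (on the `k`-vector space `V`). -/
def IsRightAction (act : V ⊗[k] H →ₗ[k] V) : Prop :=
  (∀ v, act (v ⊗ₜ (1 : H)) = v) ∧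
  (∀ (v : V) (a b : H), act (v ⊗ₜ (a * b)) = act (act (v ⊗ₜ a) ⊗ₜ b))

/-- `act : H ⊗ V → V` is a left `H`-module structure. -/
def IsLeftAction (act : H ⊗[k] V →ₗ[k] V) : Prop :=
  (∀ v, act ((1 : H) ⊗ₜ v) = v) ∧
  (∀ (a b : H) (v : V), act ((a * b) ⊗ₜ v) = act (a ⊗ₜ act (b ⊗ₜ v)))

/-- The Yetter-Drinfeld (crossed module) compatibility:
`v₍₀₎◁h₁ ⊗ v₍₁₎h₂ = (v◁h₂)₍₀₎ ⊗ h₁(v◁h₂)₍₁₎`. -/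
def IsYetterDrinfeld (act : V ⊗[k] H →ₗ[k] V) (ρ : V →ₗ[k] V ⊗[k] H) : Prop :=
  (TensorProduct.map act (LinearMap.mul' k H)) ∘ₗ
      (tensorTensorTensorComm k V H H H).toLinearMap ∘ₗ
      (TensorProduct.map ρ (Coalgebra.comul (R := k) (A := H))) =
  (LinearMap.lTensor V (LinearMap.mul' k H)) ∘ₗ
      (TensorProduct.leftComm k H V H).toLinearMap ∘ₗ
      (LinearMap.lTensor H ρ) ∘ₗ (LinearMap.lTensor H act) ∘ₗ
      (TensorProduct.leftComm k V H H).toLinearMap ∘ₗ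
      (LinearMap.lTensor V (Coalgebra.comul (R := k) (A := H)))

end Props

/-- A Hopf bimodule over `H`: a `k`-vector space with a left and a right `H`-action,
a left and a right `H`-coaction, all pairwise compatible. -/
structure HopfBimodule where
  V : Type
  [acg : AddCommGroup V]
  [mod : Module k V]
  lact : H ⊗[k] V →ₗ[k] V
  ract : V ⊗[k] H →ₗ[k] V
  lam : V →ₗ[k] H ⊗[k] V
  ρ : V →ₗ[k] V ⊗[k] H
  lact_action : IsLeftAction lact
  ract_action : IsRightAction ract
  lam_coaction : IsLeftCoaction lam
  ρ_coaction : IsRightCoaction ρ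
  /-- bimodule: the two actions commute -/
  acts_comm : ∀ (h : H) (v : V) (g : H), ract (lact (h ⊗ₜ v) ⊗ₜ g) = lact (h ⊗ₜ ract (v ⊗ₜ g))
  /-- bicomodule: the two coactions commute -/
  coacts_comm : ∀ v, (LinearMap.rTensor H lam) (ρ v) =
    (TensorProduct.assoc k H V H).symm ((LinearMap.lTensor H ρ) (lam v))
  /-- left covariance of the left action: `λ(h▷v) = h₁v₍₋₁₎ ⊗ h₂▷v₍₀₎` -/
  lact_lam : lam ∘ₗ lact =
    (TensorProduct.map (LinearMap.mul' k H) lact) ∘ₗ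
      (tensorTensorTensorComm k H H H V).toLinearMap ∘ₗ
      (TensorProduct.map (Coalgebra.comul (R := k) (A := H)) lam)
  /-- right covariance of the left action: `ρ(h▷v) = h₁▷v₍₀₎ ⊗ h₂v₍₁₎` -/
  lact_ρ : ρ ∘ₗ lact =
    (TensorProduct.map lact (LinearMap.mul' k H)) ∘ₗ
      (tensorTensorTensorComm k H H V H).toLinearMap ∘ₗ
      (TensorProduct.map (Coalgebra.comul (R := k) (A := H)) ρ)
  /-- left covariance of the right action: `λ(v◁h) = v₍₋₁₎h₁ ⊗ v₍₀₎◁h₂` -/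
  ract_lam : lam ∘ₗ ract =
    (TensorProduct.map (LinearMap.mul' k H) ract) ∘ₗ
      (tensorTensorTensorComm k H V H H).toLinearMap ∘ₗ
      (TensorProduct.map lam (Coalgebra.comul (R := k) (A := H)))
  /-- right covariance of the right action: `ρ(v◁h) = v₍₀₎◁h₁ ⊗ v₍₁₎h₂` -/
  ract_ρ : ρ ∘ₗ ract =
    (TensorProduct.map ract (LinearMap.mul' k H)) ∘ₗ
      (tensorTensorTensorComm k V H H H).toLinearMap ∘ₗ
      (TensorProduct.map ρ (Coalgebra.comul (R := k) (A := H)))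

attribute [instance] HopfBimodule.acg HopfBimodule.mod

/-- A right crossed `H`-module (Yetter-Drinfeld module). -/
structure CrossedModule where
  V : Type
  [acg : AddCommGroup V]
  [mod : Module k V]
  ract : V ⊗[k] H →ₗ[k] V
  ρ : V →ₗ[k] V ⊗[k] H
  ract_action : IsRightAction ract
  ρ_coaction : IsRightCoaction ρ
  yd : IsYetterDrinfeld ract ρ

attribute [instance] CrossedModule.acg CrossedModule.mod

namespace HopfBimodule
variable {k H}

/-- Morphisms of Hopf bimodules: linear maps preserving all four structures. -/
def Pres (X Y : HopfBimodule k H) (f : X.V →ₗ[k] Y.V) : Prop :=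
  (∀ h v, f (X.lact (h ⊗ₜ v)) = Y.lact (h ⊗ₜ f v)) ∧
  (∀ v h, f (X.ract (v ⊗ₜ h)) = Y.ract (f v ⊗ₜ h)) ∧
  (∀ v, Y.lam (f v) = (LinearMap.lTensor H f) (X.lam v)) ∧
  (∀ v, Y.ρ (f v) = (LinearMap.rTensor H f) (X.ρ v))

instance : Category (HopfBimodule k H) where
  Hom X Y := {f : X.V →ₗ[k] Y.V // Pres X Y f}
  id X := ⟨LinearMap.id, fun _ _ => rfl, fun _ _ => rfl,
    fun v => by simp [LinearMap.lTensor_id], fun v => by simp [LinearMap.rTensor_id]⟩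
  comp {X Y Z} f g := ⟨g.1 ∘ₗ f.1, by
    obtain ⟨f, hf1, hf2, hf3, hf4⟩ := f
    obtain ⟨g, hg1, hg2, hg3, hg4⟩ := g
    refine ⟨fun h v => ?_, fun v h => ?_, fun v => ?_, fun v => ?_⟩
    · simp [hf1, hg1]
    · simp [hf2, hg2]
    · simp only [LinearMap.comp_apply]
      rw [hg3, hf3, ← LinearMap.comp_apply, ← LinearMap.lTensor_comp]
    · simp only [LinearMap.comp_apply]
      rw [hg4, hf4, ← LinearMap.comp_apply, ← LinearMap.rTensor_comp]⟩
  id_comp f := Subtype.ext (LinearMap.comp_id _)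
  comp_id f := Subtype.ext (LinearMap.id_comp _)
  assoc f g h := Subtype.ext rfl

end HopfBimodule

namespace CrossedModule
variable {k H}

/-- Morphisms of crossed modules: linear maps preserving action and coaction. -/
def Pres (X Y : CrossedModule k H) (f : X.V →ₗ[k] Y.V) : Prop :=
  (∀ v h, f (X.ract (v ⊗ₜ h)) = Y.ract (f v ⊗ₜ h)) ∧
  (∀ v, Y.ρ (f v) = (LinearMap.rTensor H f) (X.ρ v))

instance : Category (CrossedModule k H) where
  Hom X Y := {f : X.V →ₗ[k] Y.V // Pres X Y f}
  id X := ⟨LinearMap.id, fun _ _ => rfl, fun v => by simp [LinearMap.rTensor_id]⟩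
  comp {X Y Z} f g := ⟨g.1 ∘ₗ f.1, by
    obtain ⟨f, hf1, hf2⟩ := f
    obtain ⟨g, hg1, hg2⟩ := g
    refine ⟨fun v h => ?_, fun v => ?_⟩
    · simp [hf1, hg1]
    · simp only [LinearMap.comp_apply]
      rw [hg2, hf2, ← LinearMap.comp_apply, ← LinearMap.rTensor_comp]⟩
  id_comp f := Subtype.ext (LinearMap.comp_id _)
  comp_id f := Subtype.ext (LinearMap.id_comp _)
  assoc f g h := Subtype.ext rfl

end CrossedModule

section Lemmas
variable {k H}

lemma map_tensorTensorTensorComm_tmul {A B C D E F : Type} [AddCommGroup A] [AddCommGroup B]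
    [AddCommGroup C] [AddCommGroup D] [AddCommGroup E] [AddCommGroup F] [Module k A] [Module k B]
    [Module k C] [Module k D] [Module k E] [Module k F] (f : A ⊗[k] C →ₗ[k] E)
    (g : B ⊗[k] D →ₗ[k] F) (x : A ⊗[k] B) (y : C ⊗[k] D) :
    map f g (tensorTensorTensorComm k A B C D (x ⊗ₜ y)) = map₂ (curry f) (curry g) x y := by
  induction x with
  | zero => simp
  | add a b ha hb => simp only [add_tmul, map_add, LinearMap.add_apply, ha, hb]
  | tmul a b =>
    induction y with
    | zero => simp
    | add c d hc hd => simp only [tmul_add, map_add, hc, hd]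
    | tmul c d => simp

lemma curry_mul' : curry (LinearMap.mul' k H) = LinearMap.mul k H := by
  ext; simp

/-- The map `a ⊗ b ↦ (v ◁ b)₍₀₎ ⊗ a (v ◁ b)₍₁₎`. -/
def mulCoactAct {V : Type} [AddCommGroup V] [Module k V] (act : V ⊗[k] H →ₗ[k] V)
    (ρ : V →ₗ[k] V ⊗[k] H) (v : V) : H ⊗[k] H →ₗ[k] V ⊗[k] H :=
  lift (((LinearMap.lTensorHom V).comp (LinearMap.mul k H)).compl₂ (ρ ∘ₗ curry act v))

lemma mulCoactAct_tmul {V : Type} [AddCommGroup V] [Module k V] (act : V ⊗[k] H →ₗ[k] V)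
    (ρ : V →ₗ[k] V ⊗[k] H) (v : V) (a b : H) :
    mulCoactAct act ρ v (a ⊗ₜ b) =
      LinearMap.lTensor V (LinearMap.mul k H a) (ρ (act (v ⊗ₜ b))) := by
  simp [mulCoactAct]

lemma isYetterDrinfeld_iff {V : Type} [AddCommGroup V] [Module k V] (act : V ⊗[k] H →ₗ[k] V)
    (ρ : V →ₗ[k] V ⊗[k] H) :
    IsYetterDrinfeld act ρ ↔ ∀ v h,
      map₂ (curry act) (LinearMap.mul k H) (ρ v) (Coalgebra.comul h) =
        mulCoactAct act ρ v (Coalgebra.comul h) := by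
  have key : ∀ v (y : H ⊗[k] H), LinearMap.lTensor V (LinearMap.mul' k H)
      (leftComm k H V H (LinearMap.lTensor H ρ (LinearMap.lTensor H act
        (leftComm k V H H (v ⊗ₜ y))))) = mulCoactAct act ρ v y := by
    intro v y
    induction y with
    | zero => simp
    | add c d hc hd => simp only [tmul_add, map_add, hc, hd]
    | tmul c d =>
      simp only [leftComm_tmul, LinearMap.lTensor_tmul, mulCoactAct_tmul]
      generalize ρ (act (v ⊗ₜ d)) = z
      induction z with
      | zero => simp
      | add c d hc hd => simp only [tmul_add, map_add, hc, hd]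
      | tmul c d => simp
  have key' : ∀ v h, (map act (LinearMap.mul' k H) ∘ₗ
      (tensorTensorTensorComm k V H H H).toLinearMap ∘ₗ map ρ Coalgebra.comul) (v ⊗ₜ h) =
      map₂ (curry act) (LinearMap.mul k H) (ρ v) (Coalgebra.comul h) := by
    intro v h
    simp [map_tensorTensorTensorComm_tmul, curry_mul']
  constructor
  · intro yd v h
    rw [← key', yd, ← key]
    rfl
  · intro yd
    refine TensorProduct.ext' fun v h => ?_
    rw [key', yd, ← key]
    rfl

end Lemmas

namespace CrossedModule
variable {k H} (X : CrossedModule k H)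

/-- The right action in curried form. -/
abbrev act : X.V →ₗ[k] H →ₗ[k] X.V := curry X.ract

lemma act_mul (v : X.V) (a b : H) : X.act v (a * b) = X.act (X.act v a) b :=
  X.ract_action.2 v a b

lemma act_one (v : X.V) : X.act v 1 = v := X.ract_action.1 v

/-- The left action of `H` on the free left module `H ⊗ V`. -/
def freeLact : H ⊗[k] (H ⊗[k] X.V) →ₗ[k] H ⊗[k] X.V :=
  LinearMap.rTensor X.V (LinearMap.mul' k H) ∘ₗ (TensorProduct.assoc k H H X.V).symm.toLinearMap

/-- The diagonal right action of `H` on `H ⊗ V`. -/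
def freeRact : (H ⊗[k] X.V) ⊗[k] H →ₗ[k] H ⊗[k] X.V :=
  lift ((map₂ (LinearMap.mul k H) X.act).compl₂ Coalgebra.comul)

/-- The left coaction of `H` on the cofree left comodule `H ⊗ V`. -/
def freeLam : H ⊗[k] X.V →ₗ[k] H ⊗[k] (H ⊗[k] X.V) :=
  (TensorProduct.assoc k H H X.V).toLinearMap ∘ₗ LinearMap.rTensor X.V Coalgebra.comul

/-- The codiagonal right coaction of `H` on `H ⊗ V`. -/
def freeRho : H ⊗[k] X.V →ₗ[k] (H ⊗[k] X.V) ⊗[k] H :=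
  lift ((map₂ (TensorProduct.mk k H X.V) (LinearMap.mul k H)).compl₁₂ Coalgebra.comul X.ρ)

@[simp] lemma freeLact_tmul (h g : H) (v : X.V) :
    X.freeLact (h ⊗ₜ (g ⊗ₜ v)) = (h * g) ⊗ₜ v := by
  simp [freeLact]

@[simp] lemma freeRact_tmul (x : H ⊗[k] X.V) (h : H) :
    X.freeRact (x ⊗ₜ h) = map₂ (LinearMap.mul k H) X.act x (Coalgebra.comul h) := by
  simp [freeRact]

@[simp] lemma freeLam_tmul (g : H) (v : X.V) :
    X.freeLam (g ⊗ₜ v) = TensorProduct.assoc k H H X.V (Coalgebra.comul g ⊗ₜ v) := by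
  simp [freeLam]

@[simp] lemma freeRho_tmul (g : H) (v : X.V) :
    X.freeRho (g ⊗ₜ v) =
      map₂ (TensorProduct.mk k H X.V) (LinearMap.mul k H) (Coalgebra.comul g) (X.ρ v) := by
  simp [freeRho]

lemma freeLact_action : IsLeftAction X.freeLact := by
  constructor
  · intro x
    induction x with
    | zero => simp
    | add a b ha hb => simp only [tmul_add, map_add, ha, hb]
    | tmul g v => simp
  · intro a b x
    induction x with
    | zero => simp
    | add a b ha hb => simp only [tmul_add, map_add, ha, hb]
    | tmul g v => simp [mul_assoc]

lemma map₂_mul_act_mul (x : H ⊗[k] X.V) (y z : H ⊗[k] H) :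
    map₂ (LinearMap.mul k H) X.act x (y * z) =
      map₂ (LinearMap.mul k H) X.act (map₂ (LinearMap.mul k H) X.act x y) z := by
  induction x with
  | zero => simp
  | add a b ha hb => simp only [map_add, LinearMap.add_apply, ha, hb]
  | tmul g v =>
    induction y with
    | zero => simp
    | add a b ha hb => simp only [map_add, LinearMap.add_apply, add_mul, ha, hb]
    | tmul a b =>
      induction z with
      | zero => simp
      | add a b ha hb => simp only [map_add, mul_add, ha, hb]
      | tmul c d =>
        simp only [Algebra.TensorProduct.tmul_mul_tmul, map₂_apply_tmul, map_tmul, act_mul,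
          LinearMap.mul_apply', mul_assoc]

lemma freeRact_action : IsRightAction X.freeRact := by
  constructor
  · intro x
    rw [freeRact_tmul, Bialgebra.comul_one, Algebra.TensorProduct.one_def]
    induction x with
    | zero => simp
    | add a b ha hb => simp only [map_add, LinearMap.add_apply, ha, hb]
    | tmul g v => rw [map₂_apply_tmul, map_tmul, act_one, LinearMap.mul_apply', mul_one]
  · intro x a b
    simp only [freeRact_tmul, Bialgebra.comul_mul, map₂_mul_act_mul]

lemma freeLam_coaction : IsLeftCoaction X.freeLam := by
  constructor
  · intro x
    induction x with
    | zero => simp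
    | add a b ha hb => simp only [map_add, ha, hb]
    | tmul g v =>
      have : ∀ y : H ⊗[k] H, TensorProduct.lid k _ (LinearMap.rTensor (H ⊗[k] X.V)
          (Coalgebra.counit (R := k) (A := H)) (TensorProduct.assoc k H H X.V (y ⊗ₜ v))) =
          TensorProduct.lid k H (LinearMap.rTensor H Coalgebra.counit y) ⊗ₜ v := by
        intro y
        induction y with
        | zero => simp
        | add a b ha hb => simp only [map_add, add_tmul, ha, hb]
        | tmul a b => simp [smul_tmul']
      rw [freeLam_tmul, this]
      simp
  · intro x
    induction x with
    | zero => simp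
    | add a b ha hb => simp only [map_add, ha, hb]
    | tmul g v =>
      let T : H ⊗[k] (H ⊗[k] H) →ₗ[k] H ⊗[k] (H ⊗[k] (H ⊗[k] X.V)) :=
        LinearMap.lTensor H ((TensorProduct.assoc k H H X.V).toLinearMap ∘ₗ
          (TensorProduct.mk k (H ⊗[k] H) X.V).flip v)
      have h1 : ∀ y : H ⊗[k] H, LinearMap.lTensor H X.freeLam
          (TensorProduct.assoc k H H X.V (y ⊗ₜ v)) =
          T (LinearMap.lTensor H Coalgebra.comul y) := by
        intro y
        induction y with
        | zero => simp
        | add a b ha hb => simp only [map_add, add_tmul, ha, hb]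
        | tmul a b => simp [T]
      have h2 : ∀ y : H ⊗[k] H, TensorProduct.assoc k H H _ (LinearMap.rTensor (H ⊗[k] X.V)
          Coalgebra.comul (TensorProduct.assoc k H H X.V (y ⊗ₜ v))) =
          T (TensorProduct.assoc k H H H (LinearMap.rTensor H Coalgebra.comul y)) := by
        intro y
        induction y with
        | zero => simp
        | add a b ha hb => simp only [map_add, add_tmul, ha, hb]
        | tmul a b =>
          simp only [assoc_tmul, LinearMap.rTensor_tmul]
          generalize (Coalgebra.comul a : H ⊗[k] H) = z
          induction z with
          | zero => simp
          | add a b ha hb => simp only [map_add, add_tmul, ha, hb]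
          | tmul c d => simp [T]
      rw [freeLam_tmul, h1, h2, Coalgebra.coassoc_apply]

lemma freeRho_coaction : IsRightCoaction X.freeRho := by
  constructor
  · intro x
    induction x with
    | zero => simp
    | add a b ha hb => simp only [map_add, ha, hb]
    | tmul g v =>
      have : ∀ (x : H ⊗[k] H) (y : X.V ⊗[k] H), TensorProduct.rid k _
          (LinearMap.lTensor (H ⊗[k] X.V) (Coalgebra.counit (R := k) (A := H))
            (map₂ (TensorProduct.mk k H X.V) (LinearMap.mul k H) x y)) =
          TensorProduct.rid k H (LinearMap.lTensor H Coalgebra.counit x) ⊗ₜ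
            TensorProduct.rid k X.V (LinearMap.lTensor X.V Coalgebra.counit y) := by
        intro x y
        induction x with
        | zero => simp
        | add a b ha hb => simp only [map_add, add_tmul, LinearMap.add_apply, ha, hb]
        | tmul a b =>
          induction y with
          | zero => simp
          | add a b ha hb => simp only [map_add, tmul_add, ha, hb]
          | tmul c d => simp [smul_tmul', smul_smul, mul_comm]
      rw [freeRho_tmul, this, X.ρ_coaction.1]
      simp
  · intro x
    induction x with
    | zero => simp
    | add a b ha hb => simp only [map_add, ha, hb]
    | tmul g v =>
      have h1 : ∀ (x : H ⊗[k] H) (y : X.V ⊗[k] H),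
          LinearMap.rTensor H X.freeRho (map₂ (TensorProduct.mk k H X.V) (LinearMap.mul k H) x y) =
          map₂ (map₂ (TensorProduct.mk k H X.V) (LinearMap.mul k H)) (LinearMap.mul k H)
            (LinearMap.rTensor H Coalgebra.comul x) (LinearMap.rTensor H X.ρ y) := by
        intro x y
        induction x with
        | zero => simp
        | add a b ha hb => simp only [map_add, LinearMap.add_apply, ha, hb]
        | tmul a b =>
          induction y with
          | zero => simp
          | add a b ha hb => simp only [map_add, ha, hb]
          | tmul c d => simp
      have h3 : ∀ (a : H) (w : X.V) (x y : H ⊗[k] H),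
          (TensorProduct.assoc k _ H H).symm ((a ⊗ₜ[k] w) ⊗ₜ[k] (x * y)) =
          map₂ (map₂ (TensorProduct.mk k H X.V) (LinearMap.mul k H)) (LinearMap.mul k H)
            ((TensorProduct.assoc k H H H).symm (a ⊗ₜ x))
            ((TensorProduct.assoc k X.V H H).symm (w ⊗ₜ y)) := by
        intro a w x y
        induction x with
        | zero => simp
        | add a b ha hb => simp only [map_add, LinearMap.add_apply, add_mul, tmul_add, ha, hb]
        | tmul a b =>
          induction y with
          | zero => simp
          | add a b ha hb => simp only [map_add, mul_add, tmul_add, ha, hb]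
          | tmul c d => simp
      have h2 : ∀ (x : H ⊗[k] H) (y : X.V ⊗[k] H),
          (TensorProduct.assoc k _ H H).symm (LinearMap.lTensor (H ⊗[k] X.V) Coalgebra.comul
            (map₂ (TensorProduct.mk k H X.V) (LinearMap.mul k H) x y)) =
          map₂ (map₂ (TensorProduct.mk k H X.V) (LinearMap.mul k H)) (LinearMap.mul k H)
            ((TensorProduct.assoc k H H H).symm (LinearMap.lTensor H Coalgebra.comul x))
            ((TensorProduct.assoc k X.V H H).symm (LinearMap.lTensor X.V Coalgebra.comul y)) := by
        intro x y
        induction x with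
        | zero => simp
        | add a b ha hb => simp only [map_add, LinearMap.add_apply, ha, hb]
        | tmul a b =>
          induction y with
          | zero => simp
          | add a b ha hb => simp only [map_add, ha, hb]
          | tmul c d => simp [h3]
      rw [freeRho_tmul, h1, h2, X.ρ_coaction.2, Coalgebra.coassoc_symm_apply]

lemma free_acts_comm (h : H) (x : H ⊗[k] X.V) (g : H) :
    X.freeRact (X.freeLact (h ⊗ₜ x) ⊗ₜ g) = X.freeLact (h ⊗ₜ X.freeRact (x ⊗ₜ g)) := by
  induction x with
  | zero => simp
  | add a b ha hb => simp only [map_add, add_tmul, tmul_add, ha, hb]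
  | tmul a v =>
    rw [freeLact_tmul, freeRact_tmul, freeRact_tmul]
    generalize (Coalgebra.comul g : H ⊗[k] H) = z
    induction z with
    | zero => simp
    | add a b ha hb => simp only [map_add, tmul_add, ha, hb]
    | tmul c d => simp [mul_assoc]

lemma free_coacts_comm (x : H ⊗[k] X.V) :
    LinearMap.rTensor H X.freeLam (X.freeRho x) =
      (TensorProduct.assoc k H (H ⊗[k] X.V) H).symm
        (LinearMap.lTensor H X.freeRho (X.freeLam x)) := by
  induction x with
  | zero => simp
  | add a b ha hb => simp only [map_add, ha, hb]
  | tmul g v =>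
    have h1 : ∀ (x : H ⊗[k] H) (y : X.V ⊗[k] H),
        LinearMap.rTensor H X.freeLam (map₂ (TensorProduct.mk k H X.V) (LinearMap.mul k H) x y) =
        (TensorProduct.assoc k H (H ⊗[k] X.V) H).symm (LinearMap.lTensor H
          ((map₂ (TensorProduct.mk k H X.V) (LinearMap.mul k H)).flip y)
          (TensorProduct.assoc k H H H (LinearMap.rTensor H Coalgebra.comul x))) := by
      intro x y
      induction x with
      | zero => simp
      | add a b ha hb => simp only [map_add, LinearMap.add_apply, ha, hb]
      | tmul a b =>
        induction y with
        | zero => simp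
        | add a b ha hb => simp only [map_add, LinearMap.lTensor_add, LinearMap.add_apply, ha, hb]
        | tmul c d =>
          simp only [map₂_apply_tmul, LinearMap.rTensor_tmul, map_tmul, TensorProduct.mk_apply,
            freeLam_tmul]
          generalize (Coalgebra.comul a : H ⊗[k] H) = z
          induction z with
          | zero => simp
          | add a b ha hb => simp only [map_add, add_tmul, ha, hb]
          | tmul c d => simp
    have h2 : ∀ x : H ⊗[k] H,
        LinearMap.lTensor H X.freeRho (TensorProduct.assoc k H H X.V (x ⊗ₜ v)) =
        LinearMap.lTensor H ((map₂ (TensorProduct.mk k H X.V) (LinearMap.mul k H)).flip (X.ρ v))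
          (LinearMap.lTensor H Coalgebra.comul x) := by
      intro x
      induction x with
      | zero => simp
      | add a b ha hb => simp only [map_add, add_tmul, ha, hb]
      | tmul a b => simp
    rw [freeRho_tmul, freeLam_tmul, h1, h2, Coalgebra.coassoc_apply]

lemma free_lact_lam (h : H) (x : H ⊗[k] X.V) :
    X.freeLam (X.freeLact (h ⊗ₜ x)) =
      map₂ (LinearMap.mul k H) (curry X.freeLact) (Coalgebra.comul h) (X.freeLam x) := by
  induction x with
  | zero => simp
  | add a b ha hb => simp only [map_add, tmul_add, ha, hb]
  | tmul g v =>
    rw [freeLact_tmul, freeLam_tmul, freeLam_tmul, Bialgebra.comul_mul]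
    generalize (Coalgebra.comul h : H ⊗[k] H) = x
    generalize (Coalgebra.comul g : H ⊗[k] H) = y
    induction x with
    | zero => simp
    | add a b ha hb => simp only [map_add, LinearMap.add_apply, add_mul, add_tmul, ha, hb]
    | tmul a b =>
      induction y with
      | zero => simp
      | add a b ha hb => simp only [map_add, mul_add, add_tmul, ha, hb]
      | tmul c d => simp

lemma free_lact_rho (h : H) (x : H ⊗[k] X.V) :
    X.freeRho (X.freeLact (h ⊗ₜ x)) =
      map₂ (curry X.freeLact) (LinearMap.mul k H) (Coalgebra.comul h) (X.freeRho x) := by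
  induction x with
  | zero => simp
  | add a b ha hb => simp only [map_add, tmul_add, ha, hb]
  | tmul g v =>
    rw [freeLact_tmul, freeRho_tmul, freeRho_tmul, Bialgebra.comul_mul]
    generalize (Coalgebra.comul h : H ⊗[k] H) = x
    generalize (Coalgebra.comul g : H ⊗[k] H) = y
    generalize X.ρ v = z
    induction x with
    | zero => simp
    | add a b ha hb => simp only [map_add, LinearMap.add_apply, add_mul, ha, hb]
    | tmul a b =>
      induction y with
      | zero => simp
      | add a b ha hb => simp only [map_add, LinearMap.add_apply, mul_add, ha, hb]
      | tmul c d =>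
        induction z with
        | zero => simp
        | add a b ha hb => simp only [map_add, ha, hb]
        | tmul c d => simp [mul_assoc]

lemma free_ract_lam (x : H ⊗[k] X.V) (h : H) :
    X.freeLam (X.freeRact (x ⊗ₜ h)) =
      map₂ (LinearMap.mul k H) (curry X.freeRact) (X.freeLam x) (Coalgebra.comul h) := by
  induction x with
  | zero => simp
  | add a b ha hb => simp only [map_add, add_tmul, LinearMap.add_apply, ha, hb]
  | tmul g v =>
    have h1 : ∀ y : H ⊗[k] H, X.freeLam (map₂ (LinearMap.mul k H) X.act (g ⊗ₜ v) y) =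
        map₂ (LinearMap.mul k H) (map₂ (LinearMap.mul k H) X.act)
          (TensorProduct.assoc k H H X.V (Coalgebra.comul g ⊗ₜ v))
          (TensorProduct.assoc k H H H (LinearMap.rTensor H Coalgebra.comul y)) := by
      intro y
      induction y with
      | zero => simp
      | add a b ha hb => simp only [map_add, ha, hb]
      | tmul a b =>
        rw [map₂_apply_tmul, map_tmul, LinearMap.mul_apply', freeLam_tmul, Bialgebra.comul_mul,
          LinearMap.rTensor_tmul]
        generalize (Coalgebra.comul g : H ⊗[k] H) = x
        generalize (Coalgebra.comul a : H ⊗[k] H) = y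
        induction x with
        | zero => simp
        | add a b ha hb => simp only [map_add, LinearMap.add_apply, add_mul, add_tmul, ha, hb]
        | tmul a b =>
          induction y with
          | zero => simp
          | add a b ha hb => simp only [map_add, mul_add, add_tmul, ha, hb]
          | tmul c d => simp
    have h2 : ∀ (x : H ⊗[k] (H ⊗[k] X.V)) (y : H ⊗[k] H),
        map₂ (LinearMap.mul k H) (curry X.freeRact) x y =
        map₂ (LinearMap.mul k H) (map₂ (LinearMap.mul k H) X.act) x
          (LinearMap.lTensor H Coalgebra.comul y) := by
      intro x y
      induction x with
      | zero => simp
      | add a b ha hb => simp only [map_add, LinearMap.add_apply, ha, hb]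
      | tmul a b =>
        induction y with
        | zero => simp
        | add a b ha hb => simp only [map_add, ha, hb]
        | tmul c d => simp
    rw [freeRact_tmul, h1, h2, Coalgebra.coassoc_apply, freeLam_tmul]

lemma free_ract_rho (x : H ⊗[k] X.V) (h : H) :
    X.freeRho (X.freeRact (x ⊗ₜ h)) =
      map₂ (curry X.freeRact) (LinearMap.mul k H) (X.freeRho x) (Coalgebra.comul h) := by
  induction x with
  | zero => simp
  | add a b ha hb => simp only [map_add, add_tmul, LinearMap.add_apply, ha, hb]
  | tmul g v =>
    let Q (x : H ⊗[k] H) : H →ₗ[k] X.V ⊗[k] H →ₗ[k] (H ⊗[k] X.V) ⊗[k] H :=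
      map₂ (TensorProduct.mk k H X.V) (LinearMap.mul k H) ∘ₗ
        LinearMap.mul k (H ⊗[k] H) x ∘ₗ (TensorProduct.mk k H H).flip 1
    have h1 : ∀ y : H ⊗[k] H, X.freeRho (map₂ (LinearMap.mul k H) X.act (g ⊗ₜ v) y) =
        lift (Q (Coalgebra.comul g)) (LinearMap.lTensor H (mulCoactAct X.ract X.ρ v)
          (TensorProduct.assoc k H H H (LinearMap.rTensor H Coalgebra.comul y))) := by
      intro y
      induction y with
      | zero => simp
      | add a b ha hb => simp only [map_add, ha, hb]
      | tmul a b =>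
        rw [map₂_apply_tmul, map_tmul, LinearMap.mul_apply', freeRho_tmul, Bialgebra.comul_mul,
          LinearMap.rTensor_tmul]
        generalize (Coalgebra.comul g : H ⊗[k] H) = x
        generalize (Coalgebra.comul a : H ⊗[k] H) = y
        induction y with
        | zero => simp
        | add a b ha hb => simp only [map_add, LinearMap.add_apply, mul_add, add_tmul, ha, hb]
        | tmul c d =>
          simp only [assoc_tmul, LinearMap.lTensor_tmul, mulCoactAct_tmul, lift.tmul, curry_apply]
          generalize X.ρ (X.ract (v ⊗ₜ b)) = z
          induction z with
          | zero => simp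
          | add a b ha hb => simp only [map_add, ha, hb]
          | tmul w e =>
            induction x with
            | zero => simp [Q]
            | add a b ha hb =>
              simp only [Q, map_add, LinearMap.add_apply, add_mul, LinearMap.comp_apply] at ha hb ⊢
              rw [ha, hb]
            | tmul a b => simp [Q, mul_assoc]
    have h2 : ∀ (x : H ⊗[k] H) (z : X.V ⊗[k] H) (y : H ⊗[k] H),
        map₂ (curry X.freeRact) (LinearMap.mul k H)
          (map₂ (TensorProduct.mk k H X.V) (LinearMap.mul k H) x z) y =
        lift (Q x) (LinearMap.lTensor H (map₂ X.act (LinearMap.mul k H) z)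
          (TensorProduct.assoc k H H H (LinearMap.rTensor H Coalgebra.comul y))) := by
      intro x z y
      induction y with
      | zero => simp
      | add a b ha hb => simp only [map_add, ha, hb]
      | tmul a b =>
        induction z with
        | zero => simp
        | add a b ha hb =>
          simp only [map_add, LinearMap.lTensor_add, LinearMap.add_apply, ha, hb]
        | tmul w e =>
          induction x with
          | zero =>
            have hQ : lift (Q 0) = 0 := TensorProduct.ext' fun _ _ => by simp [Q]
            simp [hQ]
          | add a b ha hb =>
            have hQ : lift (Q (a + b)) = lift (Q a) + lift (Q b) :=
              TensorProduct.ext' fun _ _ => by simp [Q]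
            rw [hQ]
            simp only [map_add, LinearMap.add_apply, ha, hb]
          | tmul c d =>
            simp only [map₂_apply_tmul, map_tmul, LinearMap.rTensor_tmul, TensorProduct.mk_apply,
              curry_apply, freeRact_tmul]
            generalize (Coalgebra.comul a : H ⊗[k] H) = y
            induction y with
            | zero => simp
            | add a b ha hb => simp only [map_add, add_tmul, ha, hb]
            | tmul p q => simp [Q, mul_assoc]
    have h3 : mulCoactAct X.ract X.ρ v ∘ₗ Coalgebra.comul =
        map₂ X.act (LinearMap.mul k H) (X.ρ v) ∘ₗ Coalgebra.comul :=
      LinearMap.ext fun h => ((isYetterDrinfeld_iff _ _).1 X.yd v h).symm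
    rw [freeRact_tmul, h1, freeRho_tmul, h2, Coalgebra.coassoc_apply,
      ← LinearMap.lTensor_comp_apply, ← LinearMap.lTensor_comp_apply, h3]

/-- The Hopf bimodule `H ⊗ V` induced by a crossed module `V`. -/
def free : HopfBimodule k H where
  V := H ⊗[k] X.V
  lact := X.freeLact
  ract := X.freeRact
  lam := X.freeLam
  ρ := X.freeRho
  lact_action := X.freeLact_action
  ract_action := X.freeRact_action
  lam_coaction := X.freeLam_coaction
  ρ_coaction := X.freeRho_coaction
  acts_comm := X.free_acts_comm
  coacts_comm := X.free_coacts_comm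
  lact_lam := TensorProduct.ext' fun h x => by
    simp [map_tensorTensorTensorComm_tmul, curry_mul', free_lact_lam]
  lact_ρ := TensorProduct.ext' fun h x => by
    simp [map_tensorTensorTensorComm_tmul, curry_mul', free_lact_rho]
  ract_lam := TensorProduct.ext' fun x h => by
    simp [map_tensorTensorTensorComm_tmul, curry_mul', free_ract_lam, -freeRact_tmul]
  ract_ρ := TensorProduct.ext' fun x h => by
    simp [map_tensorTensorTensorComm_tmul, curry_mul', free_ract_rho, -freeRact_tmul]

end CrossedModule

namespace HopfBimodule
variable {k H} (M : HopfBimodule k H)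

lemma lam_lact (h : H) (m : M.V) : M.lam (M.lact (h ⊗ₜ m)) =
    map₂ (LinearMap.mul k H) (curry M.lact) (Coalgebra.comul h) (M.lam m) := by
  simpa [map_tensorTensorTensorComm_tmul, curry_mul'] using
    LinearMap.congr_fun M.lact_lam (h ⊗ₜ m)

lemma rho_lact (h : H) (m : M.V) : M.ρ (M.lact (h ⊗ₜ m)) =
    map₂ (curry M.lact) (LinearMap.mul k H) (Coalgebra.comul h) (M.ρ m) := by
  simpa [map_tensorTensorTensorComm_tmul, curry_mul'] using
    LinearMap.congr_fun M.lact_ρ (h ⊗ₜ m)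

lemma lam_ract (m : M.V) (h : H) : M.lam (M.ract (m ⊗ₜ h)) =
    map₂ (LinearMap.mul k H) (curry M.ract) (M.lam m) (Coalgebra.comul h) := by
  simpa [map_tensorTensorTensorComm_tmul, curry_mul'] using
    LinearMap.congr_fun M.ract_lam (m ⊗ₜ h)

lemma rho_ract (m : M.V) (h : H) : M.ρ (M.ract (m ⊗ₜ h)) =
    map₂ (curry M.ract) (LinearMap.mul k H) (M.ρ m) (Coalgebra.comul h) := by
  simpa [map_tensorTensorTensorComm_tmul, curry_mul'] using
    LinearMap.congr_fun M.ract_ρ (m ⊗ₜ h)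

/-- The endomorphism `m ↦ S(m₍₋₁₎) ▷ m₍₀₎`, projecting onto the left coinvariants. -/
def coinvProj : M.V →ₗ[k] M.V :=
  M.lact ∘ₗ LinearMap.rTensor M.V (HopfAlgebra.antipode k) ∘ₗ M.lam

lemma lact_coinvProj (m : M.V) : M.lact (LinearMap.lTensor H M.coinvProj (M.lam m)) = m := by
  have h1 : ∀ x : H ⊗[k] M.V,
      (M.lact ∘ₗ LinearMap.lTensor H (M.lact ∘ₗ LinearMap.rTensor M.V (HopfAlgebra.antipode k)))
        (TensorProduct.assoc k H H M.V (LinearMap.rTensor M.V Coalgebra.comul x)) =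
      TensorProduct.lid k M.V (LinearMap.rTensor M.V Coalgebra.counit x) := by
    intro x
    induction x with
    | zero => simp
    | add a b ha hb => simp only [map_add, ha, hb]
    | tmul h n =>
      have h2 : ∀ y : H ⊗[k] H, (M.lact ∘ₗ LinearMap.lTensor H (M.lact ∘ₗ
          LinearMap.rTensor M.V (HopfAlgebra.antipode k)))
            (TensorProduct.assoc k H H M.V (y ⊗ₜ n)) =
          M.lact (LinearMap.mul' k H (LinearMap.lTensor H (HopfAlgebra.antipode k) y) ⊗ₜ n) := by
        intro y
        induction y with
        | zero => simp
        | add a b ha hb => simp only [map_add, add_tmul, ha, hb]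
        | tmul a b => simp [M.lact_action.2]
      rw [LinearMap.rTensor_tmul, h2, HopfAlgebra.mul_antipode_lTensor_comul_apply]
      simp [Algebra.algebraMap_eq_smul_one, ← smul_tmul', M.lact_action.1]
  conv_rhs => rw [← M.lam_coaction.1 m, ← h1, ← M.lam_coaction.2]
  rw [LinearMap.comp_apply, ← LinearMap.lTensor_comp_apply]
  rfl

/-- Linear maps out of `M` are determined by their left convolution with an action of `H`. -/
lemma eq_of_act_lTensor_lam_eq {N : Type} [AddCommGroup N] [Module k N] {act : H ⊗[k] N →ₗ[k] N}
    (hact : IsLeftAction act) {D E : M.V →ₗ[k] N}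
    (hDE : ∀ m, act (LinearMap.lTensor H D (M.lam m)) = act (LinearMap.lTensor H E (M.lam m))) :
    D = E := by
  have key : ∀ (D : M.V →ₗ[k] N) (m : M.V),
      D m = act (LinearMap.rTensor N (HopfAlgebra.antipode k)
        (LinearMap.lTensor H (act ∘ₗ LinearMap.lTensor H D ∘ₗ M.lam) (M.lam m))) := by
    intro D m
    have h1 : ∀ x : H ⊗[k] M.V,
        (act ∘ₗ LinearMap.rTensor N (HopfAlgebra.antipode k) ∘ₗ
          LinearMap.lTensor H (act ∘ₗ LinearMap.lTensor H D))
          (TensorProduct.assoc k H H M.V (LinearMap.rTensor M.V Coalgebra.comul x)) =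
        D (TensorProduct.lid k M.V (LinearMap.rTensor M.V Coalgebra.counit x)) := by
      intro x
      induction x with
      | zero => simp
      | add a b ha hb => simp only [map_add, ha, hb]
      | tmul h n =>
        have h2 : ∀ y : H ⊗[k] H, (act ∘ₗ LinearMap.rTensor N (HopfAlgebra.antipode k) ∘ₗ
            LinearMap.lTensor H (act ∘ₗ LinearMap.lTensor H D))
              (TensorProduct.assoc k H H M.V (y ⊗ₜ n)) =
            act (LinearMap.mul' k H (LinearMap.rTensor H (HopfAlgebra.antipode k) y) ⊗ₜ D n) := by
          intro y
          induction y with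
          | zero => simp
          | add a b ha hb => simp only [map_add, add_tmul, ha, hb]
          | tmul a b => simp [hact.2]
        rw [LinearMap.rTensor_tmul, h2, HopfAlgebra.mul_antipode_rTensor_comul_apply]
        simp [Algebra.algebraMap_eq_smul_one, ← smul_tmul', hact.1]
    conv_lhs => rw [← M.lam_coaction.1 m, ← h1, ← M.lam_coaction.2]
    rw [LinearMap.comp_apply, LinearMap.comp_apply, ← LinearMap.lTensor_comp_apply]
    rfl
  have h : act ∘ₗ LinearMap.lTensor H D ∘ₗ M.lam = act ∘ₗ LinearMap.lTensor H E ∘ₗ M.lam :=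
    LinearMap.ext hDE
  ext m
  rw [key D, key E, h]

/-- The diagonal left action of `H` on `H ⊗ M`. -/
def diagLact : H ⊗[k] (H ⊗[k] M.V) →ₗ[k] H ⊗[k] M.V :=
  lift (map₂ (LinearMap.mul k H) (curry M.lact) ∘ₗ Coalgebra.comul)

@[simp] lemma diagLact_tmul (h : H) (x : H ⊗[k] M.V) : M.diagLact (h ⊗ₜ x) =
    map₂ (LinearMap.mul k H) (curry M.lact) (Coalgebra.comul h) x := by
  simp [diagLact]

lemma diagLact_action : IsLeftAction M.diagLact := by
  constructor
  · intro x
    rw [diagLact_tmul, Bialgebra.comul_one, Algebra.TensorProduct.one_def]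
    induction x with
    | zero => simp
    | add a b ha hb => simp only [map_add, ha, hb]
    | tmul g v => simp [M.lact_action.1]
  · intro a b x
    simp only [diagLact_tmul, Bialgebra.comul_mul]
    generalize (Coalgebra.comul a : H ⊗[k] H) = y
    generalize (Coalgebra.comul b : H ⊗[k] H) = z
    induction x with
    | zero => simp
    | add a b ha hb => simp only [map_add, ha, hb]
    | tmul g v =>
      induction y with
      | zero => simp
      | add a b ha hb => simp only [map_add, LinearMap.add_apply, add_mul, ha, hb]
      | tmul a b =>
        induction z with
        | zero => simp
        | add a b ha hb => simp only [map_add, LinearMap.add_apply, mul_add, ha, hb]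
        | tmul c d => simp [mul_assoc, M.lact_action.2]

lemma lam_coinvProj (m : M.V) : M.lam (M.coinvProj m) = 1 ⊗ₜ M.coinvProj m := by
  have h1 : ∀ x : H ⊗[k] M.V,
      M.diagLact (LinearMap.lTensor H (M.lam ∘ₗ M.coinvProj) x) =
        M.lam (M.lact (LinearMap.lTensor H M.coinvProj x)) := by
    intro x
    induction x with
    | zero => simp
    | add a b ha hb => simp only [map_add, ha, hb]
    | tmul h n => simp [lam_lact]
  have h2 : ∀ x : H ⊗[k] M.V,
      M.diagLact (LinearMap.lTensor H (TensorProduct.mk k H M.V 1 ∘ₗ M.coinvProj) x) =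
        LinearMap.lTensor H (M.lact ∘ₗ LinearMap.lTensor H M.coinvProj)
          (TensorProduct.assoc k H H M.V (LinearMap.rTensor M.V Coalgebra.comul x)) := by
    intro x
    induction x with
    | zero => simp
    | add a b ha hb => simp only [map_add, ha, hb]
    | tmul h n =>
      simp only [LinearMap.lTensor_tmul, diagLact_tmul, LinearMap.rTensor_tmul]
      generalize (Coalgebra.comul h : H ⊗[k] H) = y
      induction y with
      | zero => simp
      | add a b ha hb => simp only [map_add, LinearMap.add_apply, add_tmul, ha, hb]
      | tmul a b => simp
  have h3 : M.lact ∘ₗ LinearMap.lTensor H M.coinvProj ∘ₗ M.lam = LinearMap.id :=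
    LinearMap.ext M.lact_coinvProj
  refine LinearMap.congr_fun (M.eq_of_act_lTensor_lam_eq M.diagLact_action
    (D := M.lam ∘ₗ M.coinvProj) (E := TensorProduct.mk k H M.V 1 ∘ₗ M.coinvProj) fun m => ?_) m
  rw [h1, h2, lact_coinvProj, ← M.lam_coaction.2, ← LinearMap.lTensor_comp_apply,
    LinearMap.comp_assoc, h3, LinearMap.lTensor_id, LinearMap.id_apply]

lemma coinvProj_lact (h : H) (m : M.V) :
    M.coinvProj (M.lact (h ⊗ₜ m)) = (Coalgebra.counit h : k) • M.coinvProj m := by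
  simp only [coinvProj, LinearMap.comp_apply, lam_lact]
  induction M.lam m with
  | zero => simp
  | add a b ha hb => simp only [map_add, smul_add, ha, hb]
  | tmul b n =>
    have h1 : ∀ y : H ⊗[k] H, M.lact (LinearMap.rTensor M.V (HopfAlgebra.antipode k)
        (map₂ (LinearMap.mul k H) (curry M.lact) y (b ⊗ₜ n))) =
        M.lact (HopfAlgebra.antipode k b ⊗ₜ M.lact
          (LinearMap.mul' k H (LinearMap.rTensor H (HopfAlgebra.antipode k) y) ⊗ₜ n)) := by
      intro y
      induction y with
      | zero => simp
      | add a b ha hb => simp only [map_add, LinearMap.add_apply, add_tmul, tmul_add, ha, hb]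
      | tmul c d => simp [HopfAlgebra.antipode_mul_antidistrib, M.lact_action.2]
    rw [h1, HopfAlgebra.mul_antipode_rTensor_comul_apply]
    simp [Algebra.algebraMap_eq_smul_one, ← smul_tmul', M.lact_action.1]

/-- The left coinvariants of a Hopf bimodule. -/
def coinv : Submodule k M.V := LinearMap.ker (M.lam - TensorProduct.mk k H M.V 1)

lemma mem_coinv {m : M.V} : m ∈ M.coinv ↔ M.lam m = 1 ⊗ₜ m := by
  simp [coinv, sub_eq_zero]

lemma lam_coe (v : M.coinv) : M.lam v = 1 ⊗ₜ (v : M.V) := M.mem_coinv.1 v.2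

/-- The projection `m ↦ S(m₍₋₁₎) ▷ m₍₀₎` onto the left coinvariants. -/
def toCoinv : M.V →ₗ[k] M.coinv :=
  M.coinvProj.codRestrict M.coinv fun m => M.mem_coinv.2 (M.lam_coinvProj m)

lemma subtype_comp_toCoinv : M.coinv.subtype ∘ₗ M.toCoinv = M.coinvProj := rfl

@[simp] lemma coe_toCoinv (m : M.V) : (M.toCoinv m : M.V) = M.coinvProj m := rfl

@[simp] lemma toCoinv_coe (v : M.coinv) : M.toCoinv v = v := by
  ext
  simp [coinvProj, lam_coe, M.lact_action.1]

lemma toCoinv_lact (h : H) (m : M.V) :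
    M.toCoinv (M.lact (h ⊗ₜ m)) = (Coalgebra.counit h : k) • M.toCoinv m := by
  ext
  simp [coinvProj_lact]

/-- The right action `v ◁ h = S(h₁) ▷ v ◁ h₂` on the left coinvariants. -/
def coinvRact : M.coinv ⊗[k] H →ₗ[k] M.coinv :=
  M.toCoinv ∘ₗ M.ract ∘ₗ LinearMap.rTensor H M.coinv.subtype

@[simp] lemma coinvRact_tmul (v : M.coinv) (h : H) :
    M.coinvRact (v ⊗ₜ h) = M.toCoinv (M.ract ((v : M.V) ⊗ₜ h)) := by
  simp [coinvRact]

/-- The right coaction on the left coinvariants. -/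
def coinvRho : M.coinv →ₗ[k] M.coinv ⊗[k] H :=
  LinearMap.rTensor H M.toCoinv ∘ₗ M.ρ ∘ₗ M.coinv.subtype

lemma coinvRho_apply (v : M.coinv) :
    M.coinvRho v = LinearMap.rTensor H M.toCoinv (M.ρ v) := rfl

lemma toCoinv_ract_coinvProj (m : M.V) (b : H) :
    M.toCoinv (M.ract (M.coinvProj m ⊗ₜ b)) = M.toCoinv (M.ract (m ⊗ₜ b)) := by
  have h1 : ∀ x : H ⊗[k] M.V,
      M.toCoinv (M.ract (M.lact (LinearMap.lTensor H M.coinvProj x) ⊗ₜ b)) =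
      M.toCoinv (M.ract (M.coinvProj
        (TensorProduct.lid k M.V (LinearMap.rTensor M.V Coalgebra.counit x)) ⊗ₜ b)) := by
    intro x
    induction x with
    | zero => simp
    | add a b ha hb => simp only [map_add, add_tmul, ha, hb]
    | tmul h n => simp [M.acts_comm, toCoinv_lact, ← smul_tmul']
  conv_rhs => rw [← M.lact_coinvProj m, h1, M.lam_coaction.1]

lemma coinvRact_action : IsRightAction M.coinvRact := by
  constructor
  · intro v
    simp [M.ract_action.1]
  · intro v a b
    simp [M.ract_action.2, toCoinv_ract_coinvProj]

lemma rTensor_coinvProj_rho (v : M.coinv) :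
    LinearMap.rTensor H M.coinvProj (M.ρ v) = M.ρ v := by
  rw [coinvProj, ← LinearMap.comp_assoc, LinearMap.rTensor_comp_apply, M.coacts_comm, lam_coe,
    LinearMap.lTensor_tmul]
  induction M.ρ v with
  | zero => simp
  | add a b ha hb => simp only [map_add, tmul_add, ha, hb]
  | tmul w h => simp [M.lact_action.1]

lemma rTensor_subtype_coinvRho (v : M.coinv) :
    LinearMap.rTensor H M.coinv.subtype (M.coinvRho v) = M.ρ v := by
  rw [coinvRho_apply, ← LinearMap.rTensor_comp_apply, subtype_comp_toCoinv, rTensor_coinvProj_rho]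

lemma coinvRho_coaction : IsRightCoaction M.coinvRho := by
  constructor
  · intro v
    have h1 : ∀ y : M.V ⊗[k] H, TensorProduct.rid k M.coinv
        (LinearMap.lTensor M.coinv (Coalgebra.counit (R := k) (A := H))
          (LinearMap.rTensor H M.toCoinv y)) =
        M.toCoinv (TensorProduct.rid k M.V (LinearMap.lTensor M.V Coalgebra.counit y)) := by
      intro y
      induction y with
      | zero => simp
      | add a b ha hb => simp only [map_add, ha, hb]
      | tmul w h => simp
    rw [coinvRho_apply, h1, M.ρ_coaction.1, toCoinv_coe]
  · intro v
    have h1 : ∀ y : M.V ⊗[k] H, (TensorProduct.assoc k M.coinv H H).symm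
        (LinearMap.lTensor M.coinv (Coalgebra.comul (R := k) (A := H))
          (LinearMap.rTensor H M.toCoinv y)) =
        LinearMap.rTensor H (LinearMap.rTensor H M.toCoinv) ((TensorProduct.assoc k M.V H H).symm
          (LinearMap.lTensor M.V Coalgebra.comul y)) := by
      intro y
      induction y with
      | zero => simp
      | add a b ha hb => simp only [map_add, ha, hb]
      | tmul w h =>
        simp only [LinearMap.lTensor_tmul, LinearMap.rTensor_tmul]
        generalize (Coalgebra.comul h : H ⊗[k] H) = y
        induction y with
        | zero => simp
        | add a b ha hb => simp only [map_add, tmul_add, ha, hb]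
        | tmul c d => simp
    conv_rhs => rw [coinvRho_apply, h1, ← M.ρ_coaction.2]
    rw [← LinearMap.rTensor_comp_apply, ← M.rTensor_subtype_coinvRho v,
      ← LinearMap.rTensor_comp_apply]
    rfl

lemma lam_ract_coe (v : M.coinv) (h : H) : M.lam (M.ract ((v : M.V) ⊗ₜ h)) =
    LinearMap.lTensor H (curry M.ract v) (Coalgebra.comul h) := by
  rw [lam_ract, lam_coe, map₂_apply_tmul]
  congr 2
  ext
  simp

lemma rTensor_toCoinv_rho (m : M.V) : LinearMap.rTensor H M.toCoinv (M.ρ m) =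
    lift ((LinearMap.lTensorHom M.coinv ∘ₗ LinearMap.mul k H).compl₂ (M.coinvRho ∘ₗ M.toCoinv))
      (M.lam m) := by
  have h1 : ∀ x : H ⊗[k] M.V, LinearMap.rTensor H M.toCoinv
      (M.ρ (M.lact (LinearMap.lTensor H M.coinvProj x))) =
      lift ((LinearMap.lTensorHom M.coinv ∘ₗ LinearMap.mul k H).compl₂
        (M.coinvRho ∘ₗ M.toCoinv)) x := by
    intro x
    induction x with
    | zero => simp
    | add a b ha hb => simp only [map_add, ha, hb]
    | tmul a n =>
      have h2 : ∀ (y : H ⊗[k] H) (z : M.V ⊗[k] H), LinearMap.rTensor H M.toCoinv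
          (map₂ (curry M.lact) (LinearMap.mul k H) y z) =
          LinearMap.lTensor M.coinv (LinearMap.mul k H
            (TensorProduct.lid k H (LinearMap.rTensor H Coalgebra.counit y)))
            (LinearMap.rTensor H M.toCoinv z) := by
        intro y z
        induction y with
        | zero => simp
        | add a b ha hb =>
          simp only [map_add, LinearMap.add_apply, LinearMap.lTensor_add, ha, hb]
        | tmul a b =>
          induction z with
          | zero => simp
          | add a b ha hb => simp only [map_add, ha, hb]
          | tmul c d => simp [toCoinv_lact, smul_tmul']
      simp only [LinearMap.lTensor_tmul, rho_lact, h2]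
      simp [coinvRho_apply]
  rw [← h1, lact_coinvProj]

lemma coinv_yd : IsYetterDrinfeld M.coinvRact M.coinvRho := by
  rw [isYetterDrinfeld_iff]
  intro v h
  have h1 : ∀ (z : M.coinv ⊗[k] H) (y : H ⊗[k] H),
      map₂ (curry M.coinvRact) (LinearMap.mul k H) z y =
      LinearMap.rTensor H M.toCoinv (map₂ (curry M.ract) (LinearMap.mul k H)
        (LinearMap.rTensor H M.coinv.subtype z) y) := by
    intro z y
    induction z with
    | zero => simp
    | add a b ha hb => simp only [map_add, LinearMap.add_apply, ha, hb]
    | tmul a b =>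
      induction y with
      | zero => simp
      | add a b ha hb => simp only [map_add, ha, hb]
      | tmul c d => simp
  rw [h1, rTensor_subtype_coinvRho, ← rho_ract, rTensor_toCoinv_rho, lam_ract_coe]
  generalize (Coalgebra.comul h : H ⊗[k] H) = y
  induction y with
  | zero => simp
  | add a b ha hb => simp only [map_add, ha, hb]
  | tmul c d => simp [mulCoactAct_tmul]

/-- The crossed module of left coinvariants of a Hopf bimodule. -/
def coinvModule : CrossedModule k H where
  V := M.coinv
  ract := M.coinvRact
  ρ := M.coinvRho
  ract_action := M.coinvRact_action
  ρ_coaction := M.coinvRho_coaction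
  yd := M.coinv_yd

end HopfBimodule

namespace HopfBimodule
variable {k H} (M : HopfBimodule k H)

/-- The multiplication map `H ⊗ M^co → M`, which is a linear equivalence. -/
def coinvEquiv : (H ⊗[k] M.coinv) ≃ₗ[k] M.V :=
  LinearEquiv.ofLinearMap
    (M.lact ∘ₗ LinearMap.lTensor H M.coinv.subtype) (LinearMap.lTensor H M.toCoinv ∘ₗ M.lam)
    (LinearMap.ext fun m => by
      rw [LinearMap.comp_apply, LinearMap.comp_apply, LinearMap.comp_apply,
        ← LinearMap.lTensor_comp_apply, subtype_comp_toCoinv, lact_coinvProj, LinearMap.id_apply])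
    (TensorProduct.ext' fun h v => by
      have h1 : ∀ y : H ⊗[k] H, LinearMap.lTensor H M.toCoinv
          (map₂ (LinearMap.mul k H) (curry M.lact) y (1 ⊗ₜ (v : M.V))) =
          TensorProduct.rid k H (LinearMap.lTensor H Coalgebra.counit y) ⊗ₜ v := by
        intro y
        induction y with
        | zero => simp
        | add a b ha hb => simp only [map_add, LinearMap.add_apply, add_tmul, ha, hb]
        | tmul c d => simp [toCoinv_lact, smul_tmul']
      rw [LinearMap.comp_apply, LinearMap.comp_apply, LinearMap.comp_apply, LinearMap.lTensor_tmul,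
        Submodule.subtype_apply, lam_lact, lam_coe, h1]
      simp)

@[simp] lemma coinvEquiv_tmul (h : H) (v : M.coinv) :
    M.coinvEquiv (h ⊗ₜ v) = M.lact (h ⊗ₜ (v : M.V)) := rfl

lemma coinvEquiv_map₂_coinvRact (x : H ⊗[k] M.coinv) (h : H) :
    M.coinvEquiv (map₂ (LinearMap.mul k H) (curry M.coinvRact) x (Coalgebra.comul h)) =
      M.ract (M.coinvEquiv x ⊗ₜ h) := by
  induction x with
  | zero => simp
  | add a b ha hb => simp only [map_add, add_tmul, LinearMap.add_apply, ha, hb]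
  | tmul g v =>
    have h1 : ∀ y : H ⊗[k] H, M.coinvEquiv
        (map₂ (LinearMap.mul k H) (curry M.coinvRact) (g ⊗ₜ v) y) =
        M.lact (g ⊗ₜ M.lact (LinearMap.lTensor H M.coinvProj
          (LinearMap.lTensor H (curry M.ract v) y))) := by
      intro y
      induction y with
      | zero => simp
      | add a b ha hb => simp only [map_add, tmul_add, ha, hb]
      | tmul c d => simp [M.lact_action.2]
    rw [h1, ← lam_ract_coe, lact_coinvProj, ← M.acts_comm, coinvEquiv_tmul]

lemma lam_coinvEquiv_tmul (g : H) (v : M.coinv) :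
    M.lam (M.coinvEquiv (g ⊗ₜ v)) = LinearMap.lTensor H M.coinvEquiv.toLinearMap
      (TensorProduct.assoc k H H M.coinv (Coalgebra.comul g ⊗ₜ v)) := by
  rw [coinvEquiv_tmul, lam_lact, lam_coe]
  generalize (Coalgebra.comul g : H ⊗[k] H) = y
  induction y with
  | zero => simp
  | add a b ha hb => simp only [map_add, LinearMap.add_apply, add_tmul, ha, hb]
  | tmul c d => simp

lemma rho_coinvEquiv_tmul (g : H) (v : M.coinv) :
    M.ρ (M.coinvEquiv (g ⊗ₜ v)) = LinearMap.rTensor H M.coinvEquiv.toLinearMap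
      (map₂ (TensorProduct.mk k H M.coinv) (LinearMap.mul k H) (Coalgebra.comul g)
        (M.coinvRho v)) := by
  rw [coinvEquiv_tmul, rho_lact, ← rTensor_subtype_coinvRho]
  generalize (Coalgebra.comul g : H ⊗[k] H) = y
  generalize M.coinvRho v = z
  induction y with
  | zero => simp
  | add a b ha hb => simp only [map_add, LinearMap.add_apply, ha, hb]
  | tmul c d =>
    induction z with
    | zero => simp
    | add a b ha hb => simp only [map_add, ha, hb]
    | tmul a b => simp

lemma pres_coinvEquiv : Pres M.coinvModule.free M M.coinvEquiv.toLinearMap := by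
  refine ⟨fun h x => ?_, fun x h => ?_, fun x => ?_, fun x => ?_⟩
  · refine LinearMap.congr_fun (f := M.coinvEquiv.toLinearMap ∘ₗ curry M.coinvModule.freeLact h)
      (g := curry M.lact h ∘ₗ M.coinvEquiv.toLinearMap)
      (TensorProduct.ext' fun g (v : M.coinv) => ?_) x
    exact (congrArg M.coinvEquiv (M.coinvModule.freeLact_tmul h g v)).trans
      (M.lact_action.2 h g v)
  · exact (congrArg M.coinvEquiv (M.coinvModule.freeRact_tmul x h)).trans
      (M.coinvEquiv_map₂_coinvRact x h)
  · refine LinearMap.congr_fun (f := M.lam ∘ₗ M.coinvEquiv.toLinearMap)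
      (g := LinearMap.lTensor H M.coinvEquiv.toLinearMap ∘ₗ M.coinvModule.freeLam)
      (TensorProduct.ext' fun g v => ?_) x
    exact (M.lam_coinvEquiv_tmul g v).trans
      (congrArg (LinearMap.lTensor H M.coinvEquiv.toLinearMap)
        (M.coinvModule.freeLam_tmul g v).symm)
  · refine LinearMap.congr_fun (f := M.ρ ∘ₗ M.coinvEquiv.toLinearMap)
      (g := LinearMap.rTensor H M.coinvEquiv.toLinearMap ∘ₗ M.coinvModule.freeRho)
      (TensorProduct.ext' fun g v => ?_) x
    exact (M.rho_coinvEquiv_tmul g v).trans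
      (congrArg (LinearMap.rTensor H M.coinvEquiv.toLinearMap)
        (M.coinvModule.freeRho_tmul g v).symm)

/-- The inverse of a structure preserving linear equivalence preserves the structure. -/
lemma Pres.symm {X Y : HopfBimodule k H} {e : X.V ≃ₗ[k] Y.V} (he : Pres X Y e.toLinearMap) :
    Pres Y X e.symm.toLinearMap := by
  obtain ⟨h1, h2, h3, h4⟩ := he
  refine ⟨fun h v => ?_, fun v h => ?_, fun v => ?_, fun v => ?_⟩
  · obtain ⟨w, rfl⟩ := e.surjective v
    exact e.symm_apply_eq.2 (by simpa using (h1 h w).symm)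
  · obtain ⟨w, rfl⟩ := e.surjective v
    exact e.symm_apply_eq.2 (by simpa using (h2 w h).symm)
  · obtain ⟨w, rfl⟩ := e.surjective v
    have := h3 w
    simp only [LinearEquiv.coe_coe] at this ⊢
    rw [this, ← LinearMap.lTensor_comp_apply, e.symm_apply_apply, ← LinearEquiv.coe_trans,
      e.self_trans_symm]
    simp
  · obtain ⟨w, rfl⟩ := e.surjective v
    have := h4 w
    simp only [LinearEquiv.coe_coe] at this ⊢
    rw [this, ← LinearMap.rTensor_comp_apply, e.symm_apply_apply, ← LinearEquiv.coe_trans,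
      e.self_trans_symm]
    simp

/-- A structure preserving linear equivalence is an isomorphism of Hopf bimodules. -/
def isoOfPres {X Y : HopfBimodule k H} (e : X.V ≃ₗ[k] Y.V) (he : Pres X Y e.toLinearMap) :
    X ≅ Y where
  hom := ⟨e.toLinearMap, he⟩
  inv := ⟨e.symm.toLinearMap, he.symm⟩
  hom_inv_id := Subtype.ext (LinearMap.ext e.symm_apply_apply)
  inv_hom_id := Subtype.ext (LinearMap.ext e.apply_symm_apply)

end HopfBimodule

namespace CrossedModule
variable {k H}

lemma pres_lTensor {X Y : CrossedModule k H} {f : X.V →ₗ[k] Y.V} (hf : Pres X Y f) :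
    HopfBimodule.Pres X.free Y.free (LinearMap.lTensor H f) := by
  refine ⟨fun h x => ?_, fun x h => ?_, fun x => ?_, fun x => ?_⟩
  · suffices H1 : ∀ x : H ⊗[k] X.V, LinearMap.lTensor H f (X.freeLact (h ⊗ₜ x)) =
        Y.freeLact (h ⊗ₜ LinearMap.lTensor H f x) from H1 x
    intro x
    induction x with
    | zero => simp
    | add a b ha hb => simp only [map_add, tmul_add, ha, hb]
    | tmul g v => simp
  · suffices H1 : ∀ x : H ⊗[k] X.V, LinearMap.lTensor H f (X.freeRact (x ⊗ₜ h)) =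
        Y.freeRact (LinearMap.lTensor H f x ⊗ₜ h) from H1 x
    intro x
    rw [freeRact_tmul, freeRact_tmul]
    generalize (Coalgebra.comul h : H ⊗[k] H) = y
    induction x with
    | zero => simp
    | add a b ha hb => simp only [map_add, LinearMap.add_apply, ha, hb]
    | tmul g v =>
      induction y with
      | zero => simp
      | add a b ha hb => simp only [map_add, ha, hb]
      | tmul c d => simp [hf.1]
  · suffices H1 : ∀ x : H ⊗[k] X.V, Y.freeLam (LinearMap.lTensor H f x) =
        LinearMap.lTensor H (LinearMap.lTensor H f) (X.freeLam x) from H1 x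
    intro x
    induction x with
    | zero => simp
    | add a b ha hb => simp only [map_add, ha, hb]
    | tmul g v =>
      rw [LinearMap.lTensor_tmul, freeLam_tmul, freeLam_tmul]
      generalize (Coalgebra.comul g : H ⊗[k] H) = y
      induction y with
      | zero => simp
      | add a b ha hb => simp only [map_add, add_tmul, ha, hb]
      | tmul c d => simp
  · suffices H1 : ∀ x : H ⊗[k] X.V, Y.freeRho (LinearMap.lTensor H f x) =
        LinearMap.rTensor H (LinearMap.lTensor H f) (X.freeRho x) from H1 x
    intro x
    induction x with
    | zero => simp
    | add a b ha hb => simp only [map_add, ha, hb]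
    | tmul g v =>
      rw [LinearMap.lTensor_tmul, freeRho_tmul, freeRho_tmul, hf.2]
      generalize (Coalgebra.comul g : H ⊗[k] H) = y
      generalize X.ρ v = z
      induction y with
      | zero => simp
      | add a b ha hb => simp only [map_add, LinearMap.add_apply, ha, hb]
      | tmul c d =>
        induction z with
        | zero => simp
        | add a b ha hb => simp only [map_add, ha, hb]
        | tmul a b => simp

/-- The functor `V ↦ H ⊗ V` from crossed modules to Hopf bimodules. -/
def freeFunctor : CrossedModule k H ⥤ HopfBimodule k H where
  obj X := X.free
  map f := ⟨LinearMap.lTensor H f.1, pres_lTensor f.2⟩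
  map_id X := Subtype.ext (LinearMap.lTensor_id H X.V)
  map_comp f g := Subtype.ext (LinearMap.lTensor_comp H g.1 f.1)

/-- The map `h ⊗ v ↦ ε(h) v`. -/
def freeCounit (X : CrossedModule k H) : H ⊗[k] X.V →ₗ[k] X.V :=
  (TensorProduct.lid k X.V).toLinearMap ∘ₗ LinearMap.rTensor X.V Coalgebra.counit

@[simp] lemma freeCounit_tmul (X : CrossedModule k H) (h : H) (v : X.V) :
    X.freeCounit (h ⊗ₜ v) = (Coalgebra.counit h : k) • v := by
  simp [freeCounit]

lemma lTensor_freeCounit_freeLam (X : CrossedModule k H) (x : H ⊗[k] X.V) :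
    LinearMap.lTensor H X.freeCounit (X.freeLam x) = x := by
  induction x with
  | zero => simp
  | add a b ha hb => simp only [map_add, ha, hb]
  | tmul g v =>
    have h1 : ∀ y : H ⊗[k] H, LinearMap.lTensor H X.freeCounit
        (TensorProduct.assoc k H H X.V (y ⊗ₜ v)) =
        TensorProduct.rid k H (LinearMap.lTensor H Coalgebra.counit y) ⊗ₜ v := by
      intro y
      induction y with
      | zero => simp
      | add a b ha hb => simp only [map_add, add_tmul, ha, hb]
      | tmul c d => simp [smul_tmul']
    rw [freeLam_tmul, h1]
    simp

lemma freeCounit_freeRact (X : CrossedModule k H) (x : H ⊗[k] X.V) (h : H) :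
    X.freeCounit (X.freeRact (x ⊗ₜ h)) = X.ract (X.freeCounit x ⊗ₜ h) := by
  induction x with
  | zero => simp
  | add a b ha hb => simp only [map_add, add_tmul, ha, hb]
  | tmul g v =>
    have h1 : ∀ y : H ⊗[k] H, X.freeCounit (map₂ (LinearMap.mul k H) X.act (g ⊗ₜ v) y) =
        (Coalgebra.counit g : k) • X.act v
          (TensorProduct.lid k H (LinearMap.rTensor H Coalgebra.counit y)) := by
      intro y
      induction y with
      | zero => simp
      | add a b ha hb => simp only [map_add, smul_add, ha, hb]
      | tmul c d => simp [smul_smul]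
    rw [freeRact_tmul, h1]
    simp [← smul_tmul']

lemma rTensor_freeCounit_freeRho (X : CrossedModule k H) (v : X.V) :
    LinearMap.rTensor H X.freeCounit (X.freeRho (1 ⊗ₜ v)) = X.ρ v := by
  rw [freeRho_tmul, Bialgebra.comul_one, Algebra.TensorProduct.one_def]
  induction X.ρ v with
  | zero => simp
  | add a b ha hb => simp only [map_add, ha, hb]
  | tmul w h => simp

lemma freeRho_one_tmul (X : CrossedModule k H) (v : X.V) :
    X.freeRho (1 ⊗ₜ v) = LinearMap.rTensor H (TensorProduct.mk k H X.V 1) (X.ρ v) := by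
  rw [freeRho_tmul, Bialgebra.comul_one, Algebra.TensorProduct.one_def]
  induction X.ρ v with
  | zero => simp
  | add a b ha hb => simp only [map_add, ha, hb]
  | tmul w h => simp

/-- The linear map `v ↦ (ε ⊗ id)(φ(1 ⊗ v))`. -/
def restrict {X Y : CrossedModule k H} (φ : H ⊗[k] X.V →ₗ[k] H ⊗[k] Y.V) : X.V →ₗ[k] Y.V :=
  Y.freeCounit ∘ₗ φ ∘ₗ TensorProduct.mk k H X.V 1

@[simp] lemma restrict_apply {X Y : CrossedModule k H} (φ : H ⊗[k] X.V →ₗ[k] H ⊗[k] Y.V)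
    (v : X.V) : restrict φ v = Y.freeCounit (φ (1 ⊗ₜ v)) := rfl

lemma map_one_tmul {X Y : CrossedModule k H} {φ : H ⊗[k] X.V →ₗ[k] H ⊗[k] Y.V}
    (hφ : HopfBimodule.Pres X.free Y.free φ) (v : X.V) :
    φ (1 ⊗ₜ v) = 1 ⊗ₜ restrict φ v := by
  have h1 : Y.freeLam (φ (1 ⊗ₜ v)) = LinearMap.lTensor H φ (X.freeLam (1 ⊗ₜ v)) :=
    hφ.2.2.1 (1 ⊗ₜ v)
  rw [← Y.lTensor_freeCounit_freeLam (φ (1 ⊗ₜ v)), h1]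
  simp [Bialgebra.comul_one, Algebra.TensorProduct.one_def]

lemma lTensor_restrict {X Y : CrossedModule k H} {φ : H ⊗[k] X.V →ₗ[k] H ⊗[k] Y.V}
    (hφ : HopfBimodule.Pres X.free Y.free φ) : LinearMap.lTensor H (restrict φ) = φ :=
  TensorProduct.ext' fun h v => by
    have h1 : φ (X.freeLact (h ⊗ₜ (1 ⊗ₜ v))) = Y.freeLact (h ⊗ₜ φ (1 ⊗ₜ v)) := hφ.1 h (1 ⊗ₜ v)
    rw [map_one_tmul hφ, freeLact_tmul, freeLact_tmul, mul_one] at h1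
    exact h1.symm

lemma freeCounit_comp {X Y : CrossedModule k H} {φ : H ⊗[k] X.V →ₗ[k] H ⊗[k] Y.V}
    (hφ : HopfBimodule.Pres X.free Y.free φ) (x : H ⊗[k] X.V) :
    Y.freeCounit (φ x) = restrict φ (X.freeCounit x) := by
  conv_lhs => rw [← lTensor_restrict hφ]
  induction x with
  | zero => simp
  | add a b ha hb => simp only [map_add, ha, hb]
  | tmul h v => simp only [LinearMap.lTensor_tmul, freeCounit_tmul, map_smul]

lemma pres_restrict {X Y : CrossedModule k H} {φ : H ⊗[k] X.V →ₗ[k] H ⊗[k] Y.V}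
    (hφ : HopfBimodule.Pres X.free Y.free φ) : Pres X Y (restrict φ) := by
  constructor
  · intro v h
    have h1 : φ (X.freeRact ((1 ⊗ₜ v) ⊗ₜ h)) = Y.freeRact (φ (1 ⊗ₜ v) ⊗ₜ h) := hφ.2.1 (1 ⊗ₜ v) h
    have h2 := congrArg Y.freeCounit h1
    rw [freeCounit_comp hφ, freeCounit_freeRact, freeCounit_freeRact, freeCounit_comp hφ] at h2
    simpa using h2
  · intro v
    have h1 : Y.freeRho (φ (1 ⊗ₜ v)) = LinearMap.rTensor H φ (X.freeRho (1 ⊗ₜ v)) :=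
      hφ.2.2.2 (1 ⊗ₜ v)
    rw [← rTensor_freeCounit_freeRho, ← map_one_tmul hφ, h1, freeRho_one_tmul,
      ← LinearMap.rTensor_comp_apply, ← LinearMap.rTensor_comp_apply]
    rfl

instance : (freeFunctor (k := k) (H := H)).Faithful where
  map_injective {X Y} f g hfg := by
    refine Subtype.ext (LinearMap.ext fun v => ?_)
    have h1 : LinearMap.lTensor H f.1 = LinearMap.lTensor H g.1 := congrArg Subtype.val hfg
    simpa using congrArg Y.freeCounit (LinearMap.congr_fun h1 (1 ⊗ₜ v))

instance : (freeFunctor (k := k) (H := H)).Full where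
  map_surjective φ := ⟨⟨restrict φ.1, pres_restrict φ.2⟩, Subtype.ext (lTensor_restrict φ.2)⟩

instance : (freeFunctor (k := k) (H := H)).EssSurj where
  mem_essImage M := ⟨M.coinvModule, ⟨HopfBimodule.isoOfPres M.coinvEquiv M.pres_coinvEquiv⟩⟩

instance : (freeFunctor (k := k) (H := H)).IsEquivalence where

end CrossedModule

/-- The category of Hopf bimodules over a Hopf algebra `H` over a
field `k` is equivalent to the category of right crossed `H`-modules
(Yetter-Drinfeld modules). -/
theorem hopfBimodule_equiv_crossedModule :
    Nonempty (HopfBimodule k H ≌ CrossedModule k H) := by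
  exact ⟨CrossedModule.freeFunctor.asEquivalence.symm⟩
end
end

section
/- Let H be a Hopf algebra over a field k and let X be a right crossed H-module. Then H⊗X, equipped with the left regular H-module and left regular H-comodule structures on the factor H, and with the tensor product right H-module structure (h⊗x)◁g := hg₁ ⊗ x◁g₂ and tensor product right H-comodule structure h⊗x ↦ h₁⊗x₍₀₎ ⊗ h₂x₍₁₎, is a Hopf bimodule over H. Moreover its space of left-coinvariants is canonically isomorphic to X. -/
/- STATEMENT 2: H ⊗ X for a Yetter-Drinfeld module X is a Hopf bimodule with coinvariants X. -/

open TensorProduct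

noncomputable section

variable (k : Type) [Field k] (H : Type) [Ring H] [HopfAlgebra k H]

/-- A Hopf bimodule structure on a fixed `k`-vector space `E`. -/
structure HopfBimoduleStr (E : Type) [AddCommGroup E] [Module k E] where
  lact : H ⊗[k] E →ₗ[k] E
  ract : E ⊗[k] H →ₗ[k] E
  lam : E →ₗ[k] H ⊗[k] E
  ρ : E →ₗ[k] E ⊗[k] H
  lact_action : IsLeftAction lact
  ract_action : IsRightAction ract
  lam_coaction : IsLeftCoaction lam
  ρ_coaction : IsRightCoaction ρ
  acts_comm : ∀ (h : H) (v : E) (g : H), ract (lact (h ⊗ₜ v) ⊗ₜ g) = lact (h ⊗ₜ ract (v ⊗ₜ g))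
  coacts_comm : ∀ v, (LinearMap.rTensor H lam) (ρ v) =
    (TensorProduct.assoc k H E H).symm ((LinearMap.lTensor H ρ) (lam v))
  lact_lam : lam ∘ₗ lact =
    (TensorProduct.map (LinearMap.mul' k H) lact) ∘ₗ
      (tensorTensorTensorComm k H H H E).toLinearMap ∘ₗ
      (TensorProduct.map (Coalgebra.comul (R := k) (A := H)) lam)
  lact_ρ : ρ ∘ₗ lact =
    (TensorProduct.map lact (LinearMap.mul' k H)) ∘ₗ
      (tensorTensorTensorComm k H H E H).toLinearMap ∘ₗ
      (TensorProduct.map (Coalgebra.comul (R := k) (A := H)) ρ)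
  ract_lam : lam ∘ₗ ract =
    (TensorProduct.map (LinearMap.mul' k H) ract) ∘ₗ
      (tensorTensorTensorComm k H E H H).toLinearMap ∘ₗ
      (TensorProduct.map lam (Coalgebra.comul (R := k) (A := H)))
  ract_ρ : ρ ∘ₗ ract =
    (TensorProduct.map ract (LinearMap.mul' k H)) ∘ₗ
      (tensorTensorTensorComm k E H H H).toLinearMap ∘ₗ
      (TensorProduct.map ρ (Coalgebra.comul (R := k) (A := H)))


variable {k H}
variable {X : Type} [AddCommGroup X] [Module k X]

/-- The left `H`-coaction on `H ⊗ X` coming from the regular coaction of `H`: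
`h ⊗ x ↦ h₁ ⊗ (h₂ ⊗ x)`. -/
def regLam (X : Type) [AddCommGroup X] [Module k X] : H ⊗[k] X →ₗ[k] H ⊗[k] (H ⊗[k] X) :=
  (TensorProduct.assoc k H H X).toLinearMap ∘ₗ
    (LinearMap.rTensor X (Coalgebra.comul (R := k) (A := H)))

open Coalgebra

/-- The left regular action `g ▷ (h ⊗ x) = gh ⊗ x` on `H ⊗ X`. -/
def regLact (X : Type) [AddCommGroup X] [Module k X] : H ⊗[k] (H ⊗[k] X) →ₗ[k] H ⊗[k] X :=
  (LinearMap.rTensor X (LinearMap.mul' k H)) ∘ₗ (TensorProduct.assoc k H H X).symm.toLinearMap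

/-- The tensor product right action `(h ⊗ x) ◁ g = hg₁ ⊗ x ◁ g₂` on `H ⊗ X`. -/
def tensorRact (ract : X ⊗[k] H →ₗ[k] X) : (H ⊗[k] X) ⊗[k] H →ₗ[k] H ⊗[k] X :=
  (TensorProduct.map (LinearMap.mul' k H) ract) ∘ₗ
    (tensorTensorTensorComm k H X H H).toLinearMap ∘ₗ
    (LinearMap.lTensor (H ⊗[k] X) (Coalgebra.comul (R := k) (A := H)))

/-- The tensor product right coaction `h ⊗ x ↦ (h₁ ⊗ x₍₀₎) ⊗ h₂x₍₁₎` on `H ⊗ X`. -/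
def tensorRho (ρ : X →ₗ[k] X ⊗[k] H) : H ⊗[k] X →ₗ[k] (H ⊗[k] X) ⊗[k] H :=
  (LinearMap.lTensor (H ⊗[k] X) (LinearMap.mul' k H)) ∘ₗ
    (tensorTensorTensorComm k H H X H).toLinearMap ∘ₗ
    (TensorProduct.map (Coalgebra.comul (R := k) (A := H)) ρ)

/-- The map `(a ⊗ b) ⊗ (x ⊗ c) ↦ (a ⊗ x) ⊗ bc`. -/
def mulSecond (Y : Type) [AddCommGroup Y] [Module k Y] (X : Type) [AddCommGroup X] [Module k X] :
    (Y ⊗[k] H) ⊗[k] (X ⊗[k] H) →ₗ[k] (Y ⊗[k] X) ⊗[k] H :=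
  (LinearMap.lTensor (Y ⊗[k] X) (LinearMap.mul' k H)) ∘ₗ
    (tensorTensorTensorComm k Y H X H).toLinearMap

section Formulas

variable {Y : Type} [AddCommGroup Y] [Module k Y]

@[simp]
theorem mulSecond_tmul (a : Y) (b : H) (x : X) (c : H) :
    mulSecond (k := k) Y X ((a ⊗ₜ b) ⊗ₜ (x ⊗ₜ c)) = (a ⊗ₜ x) ⊗ₜ (b * c) := by
  simp [mulSecond]

@[simp]
theorem regLact_tmul (g h : H) (x : X) : regLact X (g ⊗ₜ[k] (h ⊗ₜ[k] x)) = (g * h) ⊗ₜ x := by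
  simp [regLact]

theorem regLam_tmul (h : H) (x : X) :
    regLam X (h ⊗ₜ[k] x) = LinearMap.lTensor H ((TensorProduct.mk k H X).flip x) (comul h) := by
  simp only [regLam, LinearMap.comp_apply, LinearMap.rTensor_tmul]
  induction comul (R := k) h with
  | zero => simp
  | tmul a b => simp
  | add u v hu hv => simp only [add_tmul, map_add, hu, hv]

theorem tensorRact_tmul (ract : X ⊗[k] H →ₗ[k] X) (h : H) (x : X) (g : H) :
    tensorRact ract ((h ⊗ₜ x) ⊗ₜ g) =
      TensorProduct.map (LinearMap.mulLeft k h) (TensorProduct.curry ract x) (comul g) := by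
  simp only [tensorRact, LinearMap.comp_apply, LinearMap.lTensor_tmul]
  induction comul (R := k) g with
  | zero => simp
  | tmul a b => simp
  | add u v hu hv => simp only [tmul_add, map_add, hu, hv]

theorem tensorRho_tmul (ρ : X →ₗ[k] X ⊗[k] H) (h : H) (x : X) :
    tensorRho ρ (h ⊗ₜ x) = mulSecond H X (comul h ⊗ₜ ρ x) := rfl

end Formulas

theorem isLeftAction_regLact : IsLeftAction (regLact (k := k) (H := H) X) := by
  refine ⟨fun v => ?_, fun a b v => ?_⟩ <;> induction v with
  | zero => simp
  | tmul h x => simp [mul_assoc]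
  | add u v hu hv => simp only [tmul_add, map_add, hu, hv]

theorem IsRightAction.tensorRact {ract : X ⊗[k] H →ₗ[k] X} (hract : IsRightAction ract) :
    IsRightAction (tensorRact ract) := by
  refine ⟨fun v => ?_, fun v a b => ?_⟩ <;> induction v with
  | zero => simp
  | tmul h x => ?_
  | add u v hu hv => simp only [add_tmul, map_add, hu, hv]
  · simp [tensorRact_tmul, Algebra.TensorProduct.one_def, hract.1]
  · simp only [tensorRact_tmul, Bialgebra.comul_mul]
    induction comul (R := k) a with
    | zero => simp
    | add u v hu hv => simp only [add_mul, add_tmul, map_add, hu, hv]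
    | tmul a₁ a₂ =>
      simp only [TensorProduct.map_tmul, tensorRact_tmul]
      induction comul (R := k) b with
      | zero => simp
      | add u v hu hv => simp only [mul_add, map_add, hu, hv]
      | tmul b₁ b₂ => simp [hract.2]

theorem isLeftCoaction_regLam : IsLeftCoaction (regLam (k := k) (H := H) X) := by
  refine ⟨fun v => ?_, fun v => ?_⟩ <;> induction v with
  | zero => simp
  | tmul h x => ?_
  | add u v hu hv => simp only [map_add, hu, hv]
  · have key := congrArg
      (fun t => (TensorProduct.mk k H X).flip x (TensorProduct.lid k H t))
      (rTensor_counit_comul (R := k) h)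
    simp only [TensorProduct.lid_tmul, one_smul, LinearMap.flip_apply, TensorProduct.mk_apply] at key
    rw [regLam_tmul]
    refine Eq.trans ?_ key
    induction comul (R := k) h with
    | zero => simp
    | tmul a b => simp [smul_tmul']
    | add u v hu hv => simp only [map_add, hu, hv, add_tmul]
  · have key := congrArg (LinearMap.lTensor H (LinearMap.lTensor H ((TensorProduct.mk k H X).flip x)))
      (coassoc_apply (R := k) h)
    rw [regLam_tmul]
    refine Eq.trans ?_ (key.symm.trans ?_) <;> clear key <;>
    induction comul (R := k) h with
    | zero => simp
    | add u v hu hv => simp only [map_add, hu, hv]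
    | tmul a b => ?_
    · simp [regLam_tmul]
    · simp only [LinearMap.rTensor_tmul, LinearMap.lTensor_tmul]
      induction comul (R := k) a with
      | zero => simp
      | add u v hu hv => simp only [add_tmul, map_add, hu, hv]
      | tmul a₁ a₂ => simp

theorem IsRightCoaction.tensorRho {ρ : X →ₗ[k] X ⊗[k] H} (hρ : IsRightCoaction ρ) :
    IsRightCoaction (tensorRho ρ) := by
  refine ⟨fun v => ?_, fun v => ?_⟩ <;> induction v with
  | zero => simp
  | tmul h x => ?_
  | add u v hu hv => simp only [map_add, hu, hv]
  · have key := congrArg₂ (fun s t => TensorProduct.rid k H s ⊗ₜ[k] t)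
      (lTensor_counit_comul (R := k) h) (hρ.1 x)
    simp only [TensorProduct.rid_tmul, one_smul] at key
    rw [tensorRho_tmul]
    refine Eq.trans ?_ key
    induction comul (R := k) h with
    | zero => simp
    | add u v hu hv => simp only [map_add, hu, hv, add_tmul]
    | tmul a b =>
      induction ρ x with
      | zero => simp
      | add u v hu hv => simp only [map_add, hu, hv, tmul_add]
      | tmul y c => simp [smul_tmul', tmul_smul, smul_smul, mul_comm]
  · have key := congrArg₂
      (fun s t => LinearMap.rTensor H (mulSecond H X) (mulSecond (H ⊗[k] H) (X ⊗[k] H) (s ⊗ₜ t)))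
      (coassoc_symm_apply (R := k) h) (hρ.2 x).symm
    rw [tensorRho_tmul]
    refine Eq.trans ?_ (key.symm.trans ?_) <;> clear key <;>
    induction comul (R := k) h with
    | zero => simp
    | add u v hu hv => simp only [map_add, hu, hv, add_tmul]
    | tmul a b => ?_
    · induction ρ x with
      | zero => simp
      | add u v hu hv => simp only [map_add, hu, hv, tmul_add]
      | tmul y c => simp [tensorRho_tmul]
    · induction ρ x with
      | zero => simp
      | add u v hu hv => simp only [map_add, hu, hv, tmul_add]
      | tmul y c =>
        simp only [mulSecond_tmul, LinearMap.lTensor_tmul, Bialgebra.comul_mul]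
        induction comul (R := k) b with
        | zero => simp
        | add u v hu hv => simp only [add_mul, map_add, hu, hv, tmul_add, add_tmul]
        | tmul b₁ b₂ =>
          induction comul (R := k) c with
          | zero => simp
          | add u v hu hv => simp only [mul_add, map_add, hu, hv, tmul_add]
          | tmul c₁ c₂ => simp

theorem tensorRact_regLact (ract : X ⊗[k] H →ₗ[k] X) (h : H) (v : H ⊗[k] X) (g : H) :
    tensorRact ract (regLact X (h ⊗ₜ v) ⊗ₜ g) = regLact X (h ⊗ₜ tensorRact ract (v ⊗ₜ g)) := by
  induction v with
  | zero => simp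
  | add u v hu hv => simp only [map_add, hu, hv, tmul_add, add_tmul]
  | tmul a x =>
    simp only [regLact_tmul, tensorRact_tmul]
    induction comul (R := k) g with
    | zero => simp
    | add u v hu hv => simp only [map_add, hu, hv, tmul_add]
    | tmul g₁ g₂ => simp

theorem regLam_tensorRho (ρ : X →ₗ[k] X ⊗[k] H) (v : H ⊗[k] X) :
    LinearMap.rTensor H (regLam X) (tensorRho ρ v) =
      (TensorProduct.assoc k H (H ⊗[k] X) H).symm
        (LinearMap.lTensor H (tensorRho ρ) (regLam X v)) := by
  induction v with
  | zero => simp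
  | add u v hu hv => simp only [map_add, hu, hv]
  | tmul h x =>
    have key := congrArg (fun s => LinearMap.rTensor H (TensorProduct.assoc k H H X).toLinearMap
      (mulSecond (H ⊗[k] H) X (s ⊗ₜ ρ x))) (coassoc_symm_apply (R := k) h)
    rw [tensorRho_tmul, regLam_tmul]
    refine Eq.trans ?_ (key.symm.trans ?_) <;> clear key <;>
    induction comul (R := k) h with
    | zero => simp
    | add u v hu hv => simp only [map_add, hu, hv, add_tmul]
    | tmul a b => ?_
    · induction ρ x with
      | zero => simp
      | add u v hu hv => simp only [map_add, hu, hv, tmul_add]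
      | tmul y c =>
        simp only [mulSecond_tmul, LinearMap.rTensor_tmul, regLam_tmul]
        induction comul (R := k) a with
        | zero => simp
        | add u v hu hv => simp only [map_add, hu, hv, add_tmul]
        | tmul a₁ a₂ => simp
    · simp only [LinearMap.lTensor_tmul, LinearMap.flip_apply, TensorProduct.mk_apply,
        tensorRho_tmul]
      induction comul (R := k) b with
      | zero => simp
      | add u v hu hv => simp only [map_add, hu, hv, tmul_add, add_tmul]
      | tmul b₁ b₂ =>
        induction ρ x with
        | zero => simp
        | add u v hu hv => simp only [map_add, hu, hv, tmul_add]
        | tmul y c => simp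

theorem regLam_comp_regLact :
    regLam (k := k) (H := H) X ∘ₗ regLact X =
      (TensorProduct.map (LinearMap.mul' k H) (regLact X)) ∘ₗ
        (tensorTensorTensorComm k H H H (H ⊗[k] X)).toLinearMap ∘ₗ
        (TensorProduct.map comul (regLam X)) := by
  ext g h x
  simp only [TensorProduct.AlgebraTensorModule.curry_apply, LinearMap.restrictScalars_self,
    TensorProduct.curry_apply, LinearMap.comp_apply, regLact_tmul, regLam_tmul,
    Bialgebra.comul_mul, TensorProduct.map_tmul]
  induction comul (R := k) g with
  | zero => simp
  | add u v hu hv => simp only [add_mul, map_add, hu, hv, add_tmul]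
  | tmul g₁ g₂ =>
    induction comul (R := k) h with
    | zero => simp
    | add u v hu hv => simp only [mul_add, map_add, hu, hv, tmul_add]
    | tmul h₁ h₂ => simp

theorem tensorRho_comp_regLact (ρ : X →ₗ[k] X ⊗[k] H) :
    tensorRho ρ ∘ₗ regLact X =
      (TensorProduct.map (regLact X) (LinearMap.mul' k H)) ∘ₗ
        (tensorTensorTensorComm k H H (H ⊗[k] X) H).toLinearMap ∘ₗ
        (TensorProduct.map comul (tensorRho ρ)) := by
  ext g h x
  simp only [TensorProduct.AlgebraTensorModule.curry_apply, LinearMap.restrictScalars_self,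
    TensorProduct.curry_apply, LinearMap.comp_apply, regLact_tmul, tensorRho_tmul,
    Bialgebra.comul_mul, TensorProduct.map_tmul]
  induction comul (R := k) g with
  | zero => simp
  | add u v hu hv => simp only [add_mul, map_add, hu, hv, add_tmul]
  | tmul g₁ g₂ =>
    induction comul (R := k) h with
    | zero => simp
    | add u v hu hv => simp only [mul_add, map_add, hu, hv, tmul_add, add_tmul]
    | tmul h₁ h₂ =>
      induction ρ x with
      | zero => simp
      | add u v hu hv => simp only [map_add, hu, hv, tmul_add]
      | tmul y c => simp [mul_assoc]

theorem regLam_comp_tensorRact (ract : X ⊗[k] H →ₗ[k] X) :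
    regLam X ∘ₗ tensorRact ract =
      (TensorProduct.map (LinearMap.mul' k H) (tensorRact ract)) ∘ₗ
        (tensorTensorTensorComm k H (H ⊗[k] X) H H).toLinearMap ∘ₗ
        (TensorProduct.map (regLam X) comul) := by
  ext h x g
  simp only [TensorProduct.AlgebraTensorModule.curry_apply, LinearMap.restrictScalars_self,
    TensorProduct.curry_apply, LinearMap.comp_apply, regLam_tmul, tensorRact_tmul, TensorProduct.map_tmul]
  have key := congrArg (TensorProduct.map (LinearMap.mul' k H) (TensorProduct.map (LinearMap.mul' k H)
      (TensorProduct.curry ract x)) ∘ₗ LinearMap.lTensor (H ⊗[k] H)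
        (TensorProduct.assoc k H H H).symm.toLinearMap ∘ₗ
        (tensorTensorTensorComm k H H H (H ⊗[k] H)).toLinearMap ∘ₗ
        TensorProduct.mk k (H ⊗[k] H) (H ⊗[k] (H ⊗[k] H)) (comul h))
    (coassoc_apply (R := k) g)
  simp only [LinearMap.comp_apply, TensorProduct.mk_apply] at key
  refine Eq.trans ?_ (key.trans ?_) <;> clear key <;>
  induction comul (R := k) g with
  | zero => simp
  | add u v hu hv => simp only [map_add, hu, hv, tmul_add]
  | tmul a b => ?_
  · simp only [TensorProduct.map_tmul, LinearMap.mulLeft_apply, regLam_tmul, Bialgebra.comul_mul,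
      LinearMap.rTensor_tmul]
    induction comul (R := k) h with
    | zero => simp
    | add u v hu hv => simp only [add_mul, map_add, hu, hv, add_tmul]
    | tmul h₁ h₂ =>
      induction comul (R := k) a with
      | zero => simp
      | add u v hu hv => simp only [mul_add, map_add, hu, hv, tmul_add, add_tmul]
      | tmul a₁ a₂ => simp
  · induction comul (R := k) h with
    | zero => simp
    | add u v hu hv => simp only [map_add, hu, hv, add_tmul]
    | tmul h₁ h₂ =>
      simp only [LinearMap.lTensor_tmul, LinearMap.flip_apply, TensorProduct.mk_apply,
        LinearEquiv.coe_coe, tensorTensorTensorComm_tmul, TensorProduct.map_tmul, tensorRact_tmul]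
      induction comul (R := k) b with
      | zero => simp
      | add u v hu hv => simp only [map_add, hu, hv, tmul_add]
      | tmul b₁ b₂ => simp

theorem IsYetterDrinfeld.tensorRho_comp_tensorRact {ract : X ⊗[k] H →ₗ[k] X}
    {ρ : X →ₗ[k] X ⊗[k] H} (hyd : IsYetterDrinfeld ract ρ) :
    tensorRho ρ ∘ₗ tensorRact ract =
      (TensorProduct.map (tensorRact ract) (LinearMap.mul' k H)) ∘ₗ
        (tensorTensorTensorComm k (H ⊗[k] X) H H H).toLinearMap ∘ₗ
        (TensorProduct.map (tensorRho ρ) comul) := by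
  ext h x g
  simp only [TensorProduct.AlgebraTensorModule.curry_apply, LinearMap.restrictScalars_self,
    TensorProduct.curry_apply, LinearMap.comp_apply, tensorRho_tmul, tensorRact_tmul,
    TensorProduct.map_tmul]
  let F : H ⊗[k] (X ⊗[k] H) →ₗ[k] (H ⊗[k] X) ⊗[k] H := mulSecond H X ∘ₗ
    LinearMap.rTensor (X ⊗[k] H) (LinearMap.mul k (H ⊗[k] H) (comul h) ∘ₗ
      (TensorProduct.mk k H H).flip 1)
  let B : H ⊗[k] H →ₗ[k] X ⊗[k] H := LinearMap.lTensor X (LinearMap.mul' k H) ∘ₗ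
    (TensorProduct.leftComm k H X H).toLinearMap ∘ₗ
    LinearMap.lTensor H (ρ ∘ₗ TensorProduct.curry ract x)
  let C : H ⊗[k] H →ₗ[k] X ⊗[k] H := TensorProduct.map ract (LinearMap.mul' k H) ∘ₗ
    (tensorTensorTensorComm k X H H H).toLinearMap ∘ₗ
    TensorProduct.mk k (X ⊗[k] H) (H ⊗[k] H) (ρ x)
  have hCB : C ∘ₗ comul = B ∘ₗ comul := by
    ext g
    refine (LinearMap.congr_fun hyd (x ⊗ₜ g)).trans ?_
    simp only [B, LinearMap.comp_apply, LinearMap.lTensor_tmul]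
    induction comul (R := k) g with
    | zero => simp
    | add u v hu hv => simp only [map_add, hu, hv, tmul_add]
    | tmul a b => simp
  have key : (F ∘ₗ LinearMap.lTensor H B) (TensorProduct.assoc k H H H
      (LinearMap.rTensor H comul (comul g))) = (F ∘ₗ LinearMap.lTensor H C)
      (TensorProduct.assoc k H H H (LinearMap.rTensor H comul (comul g))) := by
    simp only [coassoc_apply, LinearMap.comp_apply, ← LinearMap.lTensor_comp_apply, hCB]
  refine Eq.trans ?_ (key.trans ?_) <;> clear key hCB <;>
  induction comul (R := k) g with
  | zero => simp
  | add u v hu hv => simp only [map_add, hu, hv, tmul_add]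
  | tmul a b => ?_
  · simp only [TensorProduct.map_tmul, LinearMap.mulLeft_apply, tensorRho_tmul,
      Bialgebra.comul_mul, LinearMap.rTensor_tmul]
    induction comul (R := k) a with
    | zero => simp
    | add u v hu hv => simp only [mul_add, map_add, hu, hv, add_tmul]
    | tmul a₁ a₂ =>
      simp only [F, B, LinearMap.comp_apply, TensorProduct.assoc_tmul, LinearMap.lTensor_tmul,
        TensorProduct.curry_apply, LinearMap.rTensor_tmul, LinearMap.mul_apply_apply,
        LinearMap.flip_apply, TensorProduct.mk_apply, LinearEquiv.coe_coe]
      induction comul (R := k) h with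
      | zero => simp
      | add u v hu hv => simp only [add_mul, map_add, hu, hv, add_tmul]
      | tmul h₁ h₂ =>
        induction ρ (ract (x ⊗ₜ b)) with
        | zero => simp
        | add u v hu hv => simp only [map_add, hu, hv, tmul_add]
        | tmul y c => simp [mul_assoc]
  · simp only [F, C]
    induction comul (R := k) h with
    | zero => simp
    | add u v hu hv =>
      simp only [add_tmul, map_add, hu, hv, LinearMap.add_comp, LinearMap.comp_add,
        LinearMap.rTensor_add, LinearMap.add_apply]
    | tmul h₁ h₂ =>
      induction ρ x with
      | zero => simp
      | add u v hu hv =>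
        simp only [tmul_add, map_add, add_tmul, hu, hv, LinearMap.comp_add,
          LinearMap.lTensor_add, LinearMap.add_apply]
      | tmul y c =>
        simp only [mulSecond_tmul, tensorTensorTensorComm_tmul, TensorProduct.map_tmul,
          LinearMap.rTensor_tmul, LinearEquiv.coe_coe, tensorRact_tmul]
        induction comul (R := k) a with
        | zero => simp
        | add u v hu hv => simp only [map_add, hu, hv, add_tmul]
        | tmul a₁ a₂ => simp [mul_assoc]

theorem injective_mk_one : Function.Injective (TensorProduct.mk k H X 1) := by
  refine Function.LeftInverse.injective
    (g := TensorProduct.lid k X ∘ LinearMap.rTensor X (counit (R := k) (A := H))) fun x => ?_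
  simp

theorem range_mk_one_eq_ker : LinearMap.range (TensorProduct.mk k H X 1) =
    LinearMap.ker (regLam X - TensorProduct.mk k H (H ⊗[k] X) 1) := by
  ext v
  simp only [LinearMap.mem_range, LinearMap.mem_ker, LinearMap.sub_apply, sub_eq_zero]
  constructor
  · rintro ⟨x, rfl⟩
    simp [regLam_tmul, Algebra.TensorProduct.one_def]
  · intro hv
    refine ⟨TensorProduct.lid k X (LinearMap.rTensor X counit v), ?_⟩
    have key := congrArg (LinearMap.lTensor H
      ((TensorProduct.lid k X).toLinearMap ∘ₗ LinearMap.rTensor X (counit (R := k) (A := H)))) hv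
    refine Eq.trans ?_ (key.symm.trans ?_)
    · simp
    · clear hv key
      induction v with
      | zero => simp
      | add u v hu hv => simp only [map_add, hu, hv]
      | tmul h x =>
        have key := congrArg
          (fun t => (TensorProduct.rid k H t) ⊗ₜ[k] x) (lTensor_counit_comul (R := k) h)
        simp only [TensorProduct.rid_tmul, one_smul] at key
        rw [regLam_tmul]
        refine Eq.trans ?_ key
        induction comul (R := k) h with
        | zero => simp
        | add u v hu hv => simp only [map_add, hu, hv, add_tmul]
        | tmul a b => simp [smul_tmul']

/-- If `X` is a right crossed `H`-module then `H ⊗ X`, with the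
regular left `H`-(co)module structures on the factor `H` and the tensor product
right `H`-(co)module structures, is a Hopf bimodule over `H`, and its space of left
coinvariants is canonically isomorphic to `X` (via `x ↦ 1 ⊗ x`). -/
theorem tensor_crossedModule_hopfBimodule
    (ract : X ⊗[k] H →ₗ[k] X) (ρ : X →ₗ[k] X ⊗[k] H)
    (hract : IsRightAction ract) (hρ : IsRightCoaction ρ)
    (hyd : IsYetterDrinfeld ract ρ) :
    (∃ D : HopfBimoduleStr k H (H ⊗[k] X),
      -- left regular action: `g ▷ (h ⊗ x) = gh ⊗ x`
      D.lact = (LinearMap.rTensor X (LinearMap.mul' k H)) ∘ₗ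
          (TensorProduct.assoc k H H X).symm.toLinearMap ∧
      -- tensor product right action: `(h ⊗ x) ◁ g = hg₁ ⊗ x ◁ g₂`
      D.ract = (TensorProduct.map (LinearMap.mul' k H) ract) ∘ₗ
          (tensorTensorTensorComm k H X H H).toLinearMap ∘ₗ
          (LinearMap.lTensor (H ⊗[k] X) (Coalgebra.comul (R := k) (A := H))) ∧
      -- left regular coaction: `h ⊗ x ↦ h₁ ⊗ (h₂ ⊗ x)`
      D.lam = regLam X ∧
      -- tensor product right coaction: `h ⊗ x ↦ (h₁ ⊗ x₍₀₎) ⊗ h₂x₍₁₎`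
      D.ρ = (LinearMap.lTensor (H ⊗[k] X) (LinearMap.mul' k H)) ∘ₗ
          (tensorTensorTensorComm k H H X H).toLinearMap ∘ₗ
          (TensorProduct.map (Coalgebra.comul (R := k) (A := H)) ρ)) ∧
    -- the coinvariants of the left coaction are canonically isomorphic to `X`
    Function.Injective ((TensorProduct.mk k H X) 1) ∧
    LinearMap.range ((TensorProduct.mk k H X) 1) =
      LinearMap.ker (regLam X - (TensorProduct.mk k H (H ⊗[k] X)) 1) := by
  exact ⟨⟨{
      lact := regLact X
      ract := tensorRact ract
      lam := regLam X
      ρ := tensorRho ρ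
      lact_action := isLeftAction_regLact
      ract_action := hract.tensorRact
      lam_coaction := isLeftCoaction_regLam
      ρ_coaction := hρ.tensorRho
      acts_comm := tensorRact_regLact ract
      coacts_comm := regLam_tensorRho ρ
      lact_lam := regLam_comp_regLact
      lact_ρ := tensorRho_comp_regLact ρ
      ract_lam := regLam_comp_tensorRact ract
      ract_ρ := hyd.tensorRho_comp_tensorRact }, rfl, rfl, rfl, rfl⟩,
    injective_mk_one, range_mk_one_eq_ker⟩
end
end
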